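/- Let n = 2m, N = 2^n − 1, and F(x) = x^{d_1} + x^{d_2} on F_{2^n} with d_1, d_2 ∈ {1, …, N−1}, wt_2(d_1) = wt_2(d_2) = 2, and s = gcd(d_1, d_2, N) > 1. Assume ℓ(n) > m and #S_F = 2^m. Let α be a generator of the multiplicative group F_{2^n}^*, and set c = #{ F(α^i)^{(2^m−1)/s} : i = 1, 2, …, 2^m }. Then #Im(F) = (2^m − 1)·c/s + 1. -/

import Mathlib

open Finset

/-- The Walsh transform `W_{F_a}(ω) = Σ_v (−1)^{Tr(a·F(v)) + Tr(ω·v)}`. -/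
noncomputable def walsh {K : Type*} [Field K] [Fintype K] [Algebra (ZMod 2) K]
    (F : K → K) (a ω : K) : ℤ :=
  ∑ v : K, if Algebra.trace (ZMod 2) K (a * F v) + Algebra.trace (ZMod 2) K (ω * v) = 0
    then 1 else -1

/-- The component `F_a` is bent: all Walsh values are `±2^m`. -/
def IsBent {K : Type*} [Field K] [Fintype K] [Algebra (ZMod 2) K]
    (m : ℕ) (F : K → K) (a : K) : Prop :=
  ∀ ω : K, walsh F a ω = 2 ^ m ∨ walsh F a ω = -(2 ^ m)

/-- `wt₂(j)`: the binary digit sum of the representative of `j mod N` in `{0, …, N−1}`. -/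
def wt2 (N : ℕ) (j : ℤ) : ℕ := (Nat.digits 2 (j % (N : ℤ)).toNat).sum

/-- The `F₂`-span of the Frobenius orbit `{γ, γ², γ⁴, …}` of `γ`. -/
def frobSpan (K : Type*) [Field K] [Algebra (ZMod 2) K] (γ : K) : Submodule (ZMod 2) K :=
  Submodule.span (ZMod 2) (Set.range fun i : ℕ => γ ^ (2 ^ i))

/-- Each label `k` selects one of its two edges `k + {p, q}` and `k + {p', q'}`, according to `τ`;
`EdgeMem p q p' q' τ k v` says that `v` lies on the edge selected for `k`. -/
def EdgeMem {n : ℕ} (p q p' q' : ZMod n) (τ : ZMod n → Bool) (k v : ZMod n) : Prop :=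
  (τ k = true ∧ (v = k + p ∨ v = k + q)) ∨ (τ k = false ∧ (v = k + p' ∨ v = k + q'))

/-- `U` contains exactly one of `v`, `v + m` for every `v`. -/
def IsTransversal {n : ℕ} (m : ℕ) (U : Set (ZMod n)) : Prop :=
  ∀ v, v ∈ U ↔ v + (m : ZMod n) ∉ U

/-- Every transversal labels a perfect matching of `ZMod n`. -/
def TransversalsMatch {n : ℕ} (m : ℕ) (p q p' q' : ZMod n) : Prop :=
  ∀ U : Set (ZMod n), IsTransversal m U → ∃ τ : ZMod n → Bool,
    ∀ v, ∃! k, k ∈ U ∧ EdgeMem p q p' q' τ k v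

lemma half_add_half {n m : ℕ} (hn : n = 2 * m) : (m : ZMod n) + m = 0 := by
  have : ((2 * m : ℕ) : ZMod n) = 0 := by rw [← hn]; exact ZMod.natCast_self n
  push_cast at this
  linear_combination this

lemma val_add_half_lt_iff {n m : ℕ} (hm : 0 < m) (hn : n = 2 * m) (v : ZMod n) :
    v.val < m ↔ ¬ (v + (m : ZMod n)).val < m := by
  have : NeZero n := ⟨by omega⟩
  have hv := ZMod.val_lt v
  rw [ZMod.val_add, ZMod.val_natCast, Nat.mod_eq_of_lt (show m < n by omega)]
  rcases lt_or_ge v.val m with h | h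
  · rw [Nat.mod_eq_of_lt (by omega)]; omega
  · rw [Nat.mod_eq_sub_mod (by omega), Nat.mod_eq_of_lt (by omega)]; omega

lemma exists_transversal {n m : ℕ} (hm : 0 < m) (hn : n = 2 * m) (L : Set (ZMod n))
    (hL : ∀ x ∈ L, x + (m : ZMod n) ∉ L) : ∃ U, IsTransversal m U ∧ L ⊆ U := by
  refine ⟨{v | v ∈ L ∨ (v + (m : ZMod n) ∉ L ∧ v.val < m)}, fun v => ?_, fun v hv => Or.inl hv⟩
  have h2 : v + (m : ZMod n) + m = v := by rw [add_assoc, half_add_half hn, add_zero]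
  have h3 := val_add_half_lt_iff hm hn v
  have h4 := hL v
  have h5 := hL (v + m)
  simp only [Set.mem_ofPred_eq, h2] at *
  tauto

namespace TransversalsMatch

variable {n m : ℕ} {p q p' q' b b' : ZMod n}

lemma swap_left (h : TransversalsMatch m p q p' q') : TransversalsMatch m q p p' q' := by
  intro U hU
  obtain ⟨τ, hτ⟩ := h U hU
  refine ⟨τ, fun v => ?_⟩
  obtain ⟨k, hk, huniq⟩ := hτ v
  simp only [EdgeMem] at *
  exact ⟨k, by tauto, fun y hy => huniq y (by tauto)⟩

lemma swap_right (h : TransversalsMatch m p q p' q') : TransversalsMatch m p q q' p' := by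
  intro U hU
  obtain ⟨τ, hτ⟩ := h U hU
  refine ⟨τ, fun v => ?_⟩
  obtain ⟨k, hk, huniq⟩ := hτ v
  simp only [EdgeMem] at *
  exact ⟨k, by tauto, fun y hy => huniq y (by tauto)⟩

lemma swap (h : TransversalsMatch m p q p' q') : TransversalsMatch m p' q' p q := by
  intro U hU
  obtain ⟨τ, hτ⟩ := h U hU
  refine ⟨fun k => !τ k, fun v => ?_⟩
  obtain ⟨k, hk, huniq⟩ := hτ v
  simp only [EdgeMem, Bool.not_eq_true', Bool.not_eq_false'] at *
  exact ⟨k, by tauto, fun y hy => huniq y (by tauto)⟩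

lemma translate (h : TransversalsMatch m p q p' q') (t : ZMod n) :
    TransversalsMatch m (p - t) (q - t) (p' - t) (q' - t) := by
  intro U hU
  obtain ⟨τ, hτ⟩ := h U hU
  refine ⟨τ, fun v => ?_⟩
  obtain ⟨k, hk, huniq⟩ := hτ (v + t)
  have key : ∀ y, EdgeMem (p - t) (q - t) (p' - t) (q' - t) τ y v ↔
      EdgeMem p q p' q' τ y (v + t) := by
    intro y
    simp only [EdgeMem, add_sub_assoc', eq_sub_iff_add_eq]
  simp only [key]
  exact ⟨k, hk, huniq⟩

/-- If no two of `p, q, p', q'` differed by `m`, some transversal would avoid every label whose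
edges meet the vertex `0`. -/
lemma exists_differ (hm : 0 < m) (hn : n = 2 * m) (h : TransversalsMatch m p q p' q')
    (hpq : q ≠ p + m) (hpq' : q' ≠ p' + m) :
    p' = p + m ∨ q' = p + m ∨ p' = q + m ∨ q' = q + m := by
  by_contra! hc
  obtain ⟨h1, h2, h3, h4⟩ := hc
  have hM := half_add_half hn
  have hm0 : (m : ZMod n) ≠ 0 := by
    intro h0
    rw [ZMod.natCast_eq_zero_iff] at h0
    exact absurd (Nat.le_of_dvd hm h0) (by omega)
  obtain ⟨U, hU, hLU⟩ := exists_transversal hm hn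
    ({m - p, m - q, m - p', m - q'} : Set (ZMod n)) (by
      simp only [Set.mem_insert_iff, Set.mem_singleton_iff]
      grind)
  obtain ⟨τ, hτ⟩ := h U hU
  obtain ⟨k, ⟨hkU, hk⟩, -⟩ := hτ 0
  have hav : ∀ x ∈ ({m - p, m - q, m - p', m - q'} : Set (ZMod n)), x + m ∉ U :=
    fun x hx => (hU x).1 (hLU hx)
  simp only [Set.mem_insert_iff, Set.mem_singleton_iff] at hav
  simp only [EdgeMem] at hk
  have e1 := hav (m - p) (by simp)
  have e2 := hav (m - q) (by simp)
  have e3 := hav (m - p') (by simp)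
  have e4 := hav (m - q') (by simp)
  grind

end TransversalsMatch

lemma eq_zero_or_half {n m : ℕ} {b : ZMod n} (hm : 0 < m) (hn : n = 2 * m) (hb : 2 * b = 0) :
    b = 0 ∨ b = m := by
  have : NeZero n := ⟨by omega⟩
  rw [← ZMod.natCast_zmod_val b] at hb ⊢
  have hlt := ZMod.val_lt b
  generalize b.val = t at *
  have h2t : ((2 * t : ℕ) : ZMod n) = 0 := by push_cast; exact hb
  rw [ZMod.natCast_eq_zero_iff] at h2t
  obtain ⟨c, hc⟩ := h2t
  have htc : t = m * c := by subst hn; nlinarith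
  have hc2 : c < 2 := by
    by_contra hc2
    have : m * 2 ≤ m * c := Nat.mul_le_mul_left _ (by omega)
    omega
  interval_cases c
  · left; simp_all
  · right; simp_all

lemma half_ne_zero {n m : ℕ} (hm : 0 < m) (hn : n = 2 * m) : (m : ZMod n) ≠ 0 := by
  intro h0
  rw [ZMod.natCast_eq_zero_iff] at h0
  exact absurd (Nat.le_of_dvd hm h0) (by omega)

namespace TransversalsMatch

variable {n m : ℕ} {p q p' q' b b' : ZMod n}

/-- The matching of a transversal containing a prescribed compatible set of labels, in
existence / uniqueness form. -/
lemma exists_choice (hm : 0 < m) (hn : n = 2 * m) (h : TransversalsMatch m p q p' q')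
    (L : Set (ZMod n)) (hL : ∀ x ∈ L, x + (m : ZMod n) ∉ L) :
    ∃ (U : Set (ZMod n)) (τ : ZMod n → Bool), IsTransversal m U ∧ L ⊆ U ∧
      (∀ v, ∃ k ∈ U, EdgeMem p q p' q' τ k v) ∧
      ∀ v, ∀ k ∈ U, ∀ l ∈ U, EdgeMem p q p' q' τ k v → EdgeMem p q p' q' τ l v → k = l := by
  obtain ⟨U, hU, hLU⟩ := exists_transversal hm hn L hL
  obtain ⟨τ, hτ⟩ := h U hU
  refine ⟨U, τ, hU, hLU, fun v => ?_, fun v k hk l hl hkv hlv => ?_⟩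
  · obtain ⟨k, hk, -⟩ := hτ v
    exact ⟨k, hk⟩
  · exact (hτ v).unique ⟨hk, hkv⟩ ⟨hl, hlv⟩

lemma false_of_generic (hm : 0 < m) (hn : n = 2 * m) (h : TransversalsMatch m 0 b m b')
    (hb0 : b ≠ 0) (hbm : b ≠ m) (hb'0 : b' ≠ 0) (hb'm : b' ≠ m) (hne : b' ≠ b)
    (hne' : b' ≠ b + m) (h1 : b + b' ≠ m) (h2 : 2 * b - b' ≠ m) : False := by
  have hM := half_add_half hn
  have hm0 := half_ne_zero hm hn
  have h2b : 2 * b ≠ 0 := fun h => (eq_zero_or_half hm hn h).elim hb0 hbm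
  obtain ⟨U, τ, hU, hLU, hex, hun⟩ := h.exists_choice hm hn
    ({0, m - b, m - b', b - b' + m, -b - b'} : Set (ZMod n)) (by
      simp only [Set.mem_insert_iff, Set.mem_singleton_iff]
      generalize (m : ZMod n) = M at *
      rintro x (rfl | rfl | rfl | rfl | rfl) <;> refine fun hx => ?_ <;>
        rcases hx with hx | hx | hx | hx | hx <;> grind)
  have u0 : (0 : ZMod n) ∈ U := hLU (by simp)
  have u1 : (m : ZMod n) - b ∈ U := hLU (by simp)
  have u2 : (m : ZMod n) - b' ∈ U := hLU (by simp)
  have u3 : b - b' + (m : ZMod n) ∈ U := hLU (by simp)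
  have u4 : -b - b' ∈ U := hLU (by simp)
  have hn0 : (m : ZMod n) ∉ U := by have := (hU _).1 u0; grind
  have hn1 : -b ∉ U := by have := (hU _).1 u1; grind
  have hn2 : -b' ∉ U := by have := (hU _).1 u2; grind
  have hb : b ∈ U ∨ b + m ∈ U := by have := hU b; tauto
  simp only [EdgeMem] at hex hun
  have t0 : τ 0 = true := by
    obtain ⟨k, hk, hk'⟩ := hex 0
    grind
  have hM' : τ (m - b) = true ∨ τ (m - b') = false := by
    obtain ⟨k, hk, hk'⟩ := hex m
    grind
  cases t1 : τ (m - b)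
  · have t2 : τ (m - b') = false := by grind
    cases t4 : τ (-b - b')
    · have := hun (-b) _ u4 _ u1 (by grind) (by grind)
      grind
    · have := hun (-b') _ u4 _ u2 (by grind) (by grind)
      grind
  · have t2 : τ (m - b') = true := by
      by_contra t2
      have := hun m _ u1 _ u2 (by grind) (by grind)
      grind
    cases t3 : τ (b - b' + m)
    · rcases hb with hb | hb
      · cases t5 : τ b
        · have := hun (b + m) _ hb _ u3 (by grind) (by grind)
          grind
        · have := hun b _ hb _ u0 (by grind) (by grind)
          grind
      · cases t5 : τ (b + m)
        · have := hun b _ hb _ u0 (by grind) (by grind)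
          grind
        · have := hun (b + m) _ hb _ u3 (by grind) (by grind)
          grind
    · have := hun (b - b' + m) _ u3 _ u2 (by grind) (by grind)
      grind

lemma false_of_add_eq (hm : 0 < m) (hn : n = 2 * m) (h : TransversalsMatch m 0 b m b')
    (hb0 : b ≠ 0) (hbm : b ≠ m) (hne : b' ≠ b) (h1 : b + b' = m) : False := by
  have hM := half_add_half hn
  have hm0 := half_ne_zero hm hn
  have h2b : 2 * b ≠ 0 := fun h => (eq_zero_or_half hm hn h).elim hb0 hbm
  have h2b' : 2 * b ≠ m := by grind
  have h4b : 4 * b ≠ 0 := by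
    intro h
    rcases eq_zero_or_half (b := 2 * b) hm hn (by linear_combination h) with h | h
    · exact h2b h
    · exact h2b' h
  obtain rfl : b' = m - b := by rw [← h1]; ring
  have hcompat : ∃ L : Set (ZMod n), (∀ x ∈ L, x + (m : ZMod n) ∉ L) ∧ 0 ∈ L ∧ b ∈ L ∧
      (m : ZMod n) - b ∈ L ∧ (3 * b ≠ m → (m : ZMod n) + 2 * b ∈ L ∧ 3 * b ∈ L) := by
    by_cases h3 : 3 * b = m
    · refine ⟨{0, b, m - b}, ?_, by simp, by simp, by simp, fun h => absurd h3 h⟩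
      simp only [Set.mem_insert_iff, Set.mem_singleton_iff]
      generalize (m : ZMod n) = M at *
      rintro x (rfl | rfl | rfl) <;> refine fun hx => ?_ <;>
        rcases hx with hx | hx | hx <;> grind
    · refine ⟨{0, b, m - b, m + 2 * b, 3 * b}, ?_, by simp, by simp, by simp,
        fun _ => ⟨by simp, by simp⟩⟩
      simp only [Set.mem_insert_iff, Set.mem_singleton_iff]
      generalize (m : ZMod n) = M at *
      rintro x (rfl | rfl | rfl | rfl | rfl) <;> refine fun hx => ?_ <;>
        rcases hx with hx | hx | hx | hx | hx <;> grind
  obtain ⟨L, hL, l0, l1, l2, l3⟩ := hcompat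
  obtain ⟨U, τ, hU, hLU, hex, hun⟩ := h.exists_choice hm hn L hL
  have u0 : (0 : ZMod n) ∈ U := hLU l0
  have u1 : b ∈ U := hLU l1
  have u2 : (m : ZMod n) - b ∈ U := hLU l2
  have hn0 : (m : ZMod n) ∉ U := by have := (hU _).1 u0; grind
  have hn1 : b + m ∉ U := (hU _).1 u1
  have hn2 : -b ∉ U := by have := (hU _).1 u2; grind
  simp only [EdgeMem] at hex hun
  have t0 : τ 0 = true := by
    obtain ⟨k, hk, hk'⟩ := hex 0
    grind
  have t1 : τ b = false := by
    by_contra t1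
    have := hun b _ u0 _ u1 (by grind) (by grind)
    grind
  have t2 : τ (m - b) = false := by
    by_contra t2
    have := hun m _ u2 _ u1 (by grind) (by grind)
    grind
  by_cases h3 : 3 * b = m
  · have := hun (b + m) _ u1 _ u2 (by grind) (by grind)
    grind
  · have u3 : (m : ZMod n) + 2 * b ∈ U := hLU (l3 h3).1
    have hn3 : 2 * b ∉ U := by have := (hU _).1 u3; grind
    have hn4 : 3 * b + m ∉ U := (hU _).1 (hLU (l3 h3).2)
    obtain ⟨k, hk, hk'⟩ := hex (2 * b)
    have hk2 : k = m + 2 * b ∧ τ k = false := by grind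
    obtain ⟨rfl, t3⟩ := hk2
    have := hun b _ hk _ u0 (by grind) (by grind)
    grind

/-- If `p' = p + m` and neither edge type joins antipodes, the remaining endpoints agree
modulo `m`. -/
lemma eq_or_eq_add_half (hm : 0 < m) (hn : n = 2 * m)
    (h : TransversalsMatch m p q (p + m) q') (hpq : q ≠ p) (hpq' : q' ≠ p + m)
    (hq : q ≠ p + m) (hq' : q' ≠ p) : q' = q ∨ q' = q + m := by
  by_contra! hc
  obtain ⟨hne, hne'⟩ := hc
  have hM := half_add_half hn
  have h1 : TransversalsMatch m 0 (q - p) m (q' - p) := by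
    have := h.translate p
    rwa [sub_self, add_sub_cancel_left] at this
  have h2 : TransversalsMatch m 0 (q' - (p + (m : ZMod n))) m (q - (p + (m : ZMod n))) := by
    have := h.swap.translate (p + m)
    rwa [sub_self, show p - (p + m) = m by grind] at this
  by_cases hs : q - p + (q' - p) = m
  · exact false_of_add_eq hm hn h1 (by grind) (by grind) (by grind) hs
  by_cases ht : 2 * (q - p) - (q' - p) = m
  · exact false_of_generic hm hn h2 (by grind) (by grind) (by grind) (by grind) (by grind)
      (by grind) (by grind) (by grind)
  · exact false_of_generic hm hn h1 (by grind) (by grind) (by grind) (by grind) (by grind)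
      (by grind) hs ht

end TransversalsMatch

section BoseBurton

variable {V : Type*} [AddCommGroup V] [Module (ZMod 2) V]

lemma mem_sup_span_singleton_zmod_two {T : Submodule (ZMod 2) V} {x z : V} :
    z ∈ T ⊔ Submodule.span (ZMod 2) {x} ↔ z ∈ T ∨ z + x ∈ T := by
  rw [Submodule.mem_sup]
  constructor
  · rintro ⟨y, hy, w, hw, rfl⟩
    obtain ⟨c, rfl⟩ := Submodule.mem_span_singleton.1 hw
    rcases (show ∀ c : ZMod 2, c = 0 ∨ c = 1 by decide) c with rfl | rfl
    · left; simpa using hy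
    · right; simpa [add_assoc, ZModModule.add_self] using hy
  · rintro (h | h)
    · exact ⟨z, h, 0, by simp, by simp⟩
    · exact ⟨z + x, h, x, Submodule.mem_span_singleton_self x,
        by rw [add_assoc, ZModModule.add_self, add_zero]⟩

variable [Finite V]

/-- A subspace meeting `S` trivially extends to an `m`-dimensional one meeting `S` trivially. -/
lemma exists_avoiding_extension {m : ℕ} {S : Set V} (hV : Nat.card V = 2 ^ (2 * m))
    (hS : S.ncard = 2 ^ m) (h0 : (0 : V) ∈ S) (T : Submodule (ZMod 2) V)
    (hT : Module.finrank (ZMod 2) T ≤ m) (hTS : ∀ t ∈ T, t ∈ S → t = 0) :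
    ∃ T' : Submodule (ZMod 2) V, T ≤ T' ∧ Module.finrank (ZMod 2) T' = m ∧
      ∀ t ∈ T', t ∈ S → t = 0 := by
  obtain ⟨k, hk⟩ := Nat.exists_eq_add_of_le hT
  induction k generalizing T with
  | zero => exact ⟨T, le_rfl, by omega, hTS⟩
  | succ k ih =>
    have hcard : Nat.card (T × S) < Nat.card V := by
      rw [Nat.card_prod, Nat.card_coe_set_eq, hS, hV, Module.natCard_eq_pow_finrank (K := ZMod 2),
        Nat.card_zmod, ← pow_add]
      exact Nat.pow_lt_pow_right (by norm_num) (by omega)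
    have hns : ¬ Function.Surjective (fun z : T × S => (z.1 : V) + z.2) := fun h =>
      absurd (Nat.card_le_card_of_surjective _ h) (by omega)
    obtain ⟨x, hx⟩ := not_forall.1 hns
    have hx' : ∀ t ∈ T, ∀ s ∈ S, t + s ≠ x := fun t ht s hs h =>
      hx ⟨(⟨t, ht⟩, ⟨s, hs⟩), h⟩
    have hxT : x ∉ T := fun h => hx' x h 0 h0 (add_zero x)
    obtain ⟨T', hle, h1, h2⟩ := ih (T ⊔ Submodule.span (ZMod 2) {x})
      (by rw [Submodule.finrank_sup_span_singleton hxT]; omega)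
      (by
        intro t ht hts
        rcases mem_sup_span_singleton_zmod_two.1 ht with h | h
        · exact hTS t h hts
        · refine absurd ?_ (hx' _ h t hts)
          rw [add_right_comm, ZModModule.add_self, zero_add])
      (by rw [Submodule.finrank_sup_span_singleton hxT]; omega)
    exact ⟨T', le_sup_left.trans hle, h1, h2⟩

/-- The equality case of the Bose–Burton theorem over `F₂`: a set of `2 ^ m` vectors containing
`0` and meeting every `(m + 1)`-dimensional subspace of a `2m`-dimensional space nontrivially is
closed under addition. -/
lemma add_mem_of_blocking {m : ℕ} (hm : 0 < m) {S : Set V} (hV : Nat.card V = 2 ^ (2 * m))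
    (hS : S.ncard = 2 ^ m) (h0 : (0 : V) ∈ S)
    (hblock : ∀ T : Submodule (ZMod 2) V, Module.finrank (ZMod 2) T = m + 1 →
      ∃ t ∈ T, t ≠ 0 ∧ t ∈ S) {u v : V} (hu : u ∈ S) (hv : v ∈ S) : u + v ∈ S := by
  by_contra hw
  have hw0 : u + v ≠ 0 := fun h => hw (h ▸ h0)
  obtain ⟨T, hwT, hT, hTS⟩ := exists_avoiding_extension hV hS h0
    (Submodule.span (ZMod 2) {u + v}) (by rw [finrank_span_singleton hw0]; omega) (by
      intro t ht hts
      obtain ⟨c, rfl⟩ := Submodule.mem_span_singleton.1 ht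
      rcases (show ∀ c : ZMod 2, c = 0 ∨ c = 1 by decide) c with rfl | rfl
      · simp
      · exact absurd (by simpa using hts) hw)
  have hsurj : Function.Surjective (fun z : T × S => (z.1 : V) + z.2) := by
    intro x
    by_cases hxT : x ∈ T
    · exact ⟨(⟨x, hxT⟩, ⟨0, h0⟩), add_zero x⟩
    obtain ⟨t, ht, ht0, hts⟩ := hblock (T ⊔ Submodule.span (ZMod 2) {x})
      (by rw [Submodule.finrank_sup_span_singleton hxT, hT])
    rcases mem_sup_span_singleton_zmod_two.1 ht with h | h
    · exact absurd (hTS t h hts) ht0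
    · refine ⟨(⟨t + x, h⟩, ⟨t, hts⟩), ?_⟩
      change t + x + t = x
      rw [add_right_comm, ZModModule.add_self, zero_add]
  have hinj := (hsurj.bijective_of_nat_card_le (by
    rw [Nat.card_prod, Nat.card_coe_set_eq, hS, hV, Module.natCard_eq_pow_finrank (K := ZMod 2),
      Nat.card_zmod, hT, ← pow_add, two_mul])).injective
  have hmem : u + v ∈ T := hwT (Submodule.mem_span_singleton_self _)
  have := @hinj (⟨u + v, hmem⟩, ⟨v, hv⟩) (0, ⟨u, hu⟩) (by
    change u + v + v = (0 : V) + u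
    rw [add_assoc, ZModModule.add_self, add_zero, zero_add])
  simp only [Prod.mk.injEq, Subtype.ext_iff] at this
  exact hw0 this.1

end BoseBurton

section Walsh

/-- The character `t ↦ (-1)^t` of `F₂`. -/
def sgn (t : ZMod 2) : ℤ := if t = 0 then 1 else -1

lemma sgn_add (s t : ZMod 2) : sgn (s + t) = sgn s * sgn t := by
  revert s t; decide

lemma sum_sgn_eq_zero {A : Type*} [AddCommGroup A] [Fintype A] (φ : A →+ ZMod 2) (hφ : φ ≠ 0) :
    ∑ a, sgn (φ a) = 0 := by
  obtain ⟨x, hx⟩ : ∃ x, φ x ≠ 0 := by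
    by_contra! h
    exact hφ (AddMonoidHom.ext h)
  have h1 : sgn (φ x) = -1 := if_neg hx
  have h2 : ∑ a, sgn (φ a) = ∑ a, sgn (φ (a + x)) :=
    (Fintype.sum_equiv (Equiv.addRight x) _ _ fun _ => rfl).symm
  simp only [map_add, sgn_add, h1, ← Finset.sum_mul] at h2
  omega

end Walsh

section Bent

variable {K : Type*} [Field K] [Fintype K] [Algebra (ZMod 2) K]

local notation "Tr" => Algebra.trace (ZMod 2) K

lemma walsh_eq_sum_sgn (F : K → K) (a ω : K) :
    walsh F a ω = ∑ v, sgn (Tr (a * F v) + Tr (ω * v)) := rfl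

lemma exists_trace_mul_ne_zero {x : K} (hx : x ≠ 0) : ∃ y, Tr (x * y) ≠ 0 := by
  by_contra! h
  exact hx ((traceForm_nondegenerate (ZMod 2) K).1 x h)

/-- Nyberg's bound: an `(m + 1)`-dimensional space of components contains a nonzero one which is
not bent. -/
lemma exists_not_isBent_of_finrank {m : ℕ} (hm : 0 < m) (hcard : Fintype.card K = 2 ^ (2 * m))
    (F : K → K) (T : Submodule (ZMod 2) K) (hT : Module.finrank (ZMod 2) T = m + 1) :
    ∃ t ∈ T, t ≠ 0 ∧ ¬ IsBent m F t := by
  classical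
  by_contra! hbent
  have hTcard : Fintype.card T = 2 ^ (m + 1) := by
    rw [Module.card_eq_pow_finrank (K := ZMod 2), ZMod.card, hT]
  have h1 : (2 : ℤ) ^ (m + 1) ∣ ∑ t : T, walsh F (t : K) 0 := by
    simp only [walsh_eq_sum_sgn, zero_mul, map_zero, add_zero]
    rw [Finset.sum_comm]
    refine Finset.dvd_sum fun v _ => ?_
    let φ : T →+ ZMod 2 :=
      { toFun := fun t => Tr ((t : K) * F v)
        map_zero' := by simp
        map_add' := fun s t => by simp [add_mul] }
    by_cases hφ : φ = 0
    · have : ∀ t : T, Tr ((t : K) * F v) = 0 := fun t => DFunLike.congr_fun hφ t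
      simp [this, sgn, hTcard]
    · have := sum_sgn_eq_zero φ hφ
      exact this ▸ dvd_zero _
  have h2 : walsh F (0 : K) 0 = 2 ^ (2 * m) := by
    simp [walsh_eq_sum_sgn, sgn, hcard]
  have h3 : ∀ t : T, t ≠ 0 → (2 : ℤ) ^ (m + 1) ∣ walsh F (t : K) 0 - 2 ^ m := by
    intro t ht
    rcases hbent t t.2 (by simpa using ht) 0 with h | h
    · rw [h, sub_self]; exact dvd_zero _
    · exact ⟨-1, by rw [h]; ring⟩
  have h4 : (2 : ℤ) ^ (m + 1) ∣ ∑ t ∈ Finset.univ.erase (0 : T), (walsh F (t : K) 0 - 2 ^ m) :=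
    Finset.dvd_sum fun t ht => h3 t (Finset.ne_of_mem_erase ht)
  rw [Finset.sum_sub_distrib, Finset.sum_const, Finset.card_erase_of_mem (Finset.mem_univ _),
    Finset.card_univ, hTcard] at h4
  rw [← Finset.add_sum_erase _ _ (Finset.mem_univ (0 : T))] at h1
  have h5 := dvd_sub h1 h4
  simp only [ZeroMemClass.coe_zero, h2, nsmul_eq_mul] at h5
  rw [add_sub_assoc, sub_sub_cancel, Nat.cast_sub Nat.one_le_two_pow] at h5
  have h6 : (2 : ℤ) ^ (m + 1) ∣ 2 ^ m := by
    obtain ⟨c, hc⟩ := h5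
    obtain ⟨k, rfl⟩ : ∃ k, m = k + 1 := ⟨m - 1, by omega⟩
    refine ⟨2 ^ k + 2 ^ (k + 1) - c, ?_⟩
    push_cast at hc
    linear_combination -hc
  have h7 := Int.le_of_dvd (by positivity) h6
  have : (0 : ℤ) < 2 ^ m := by positivity
  rw [pow_succ] at h7
  omega

/-- A quadratic component is bent exactly when its polar form has trivial radical. -/
lemma isBent_iff_radical {m : ℕ} (hcard : Fintype.card K = 2 ^ (2 * m)) (F : K → K) (a : K)
    (B : LinearMap.BilinForm (ZMod 2) K)
    (hB : ∀ x y, Tr (a * F (x + y)) = Tr (a * F x) + Tr (a * F y) + B x y) :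
    IsBent m F a ↔ ∀ w, (∀ v, B v w = 0) → w = 0 := by
  constructor
  · intro hbent w hw
    by_contra hw0
    obtain ⟨ω, hω⟩ : ∃ ω, Tr (a * F w) + Tr (ω * w) = 1 := by
      obtain ⟨y, hy⟩ := exists_trace_mul_ne_zero hw0
      have hy1 : Tr (y * w) = 1 := by
        rw [mul_comm]
        exact (show ∀ c : ZMod 2, c ≠ 0 → c = 1 by decide) _ hy
      rcases (show ∀ c : ZMod 2, c = 0 ∨ c = 1 by decide) (Tr (a * F w)) with h | h
      · exact ⟨y, by rw [h, hy1, zero_add]⟩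
      · exact ⟨0, by rw [h, zero_mul, map_zero, add_zero]⟩
    have h0 : walsh F a ω = -walsh F a ω := by
      rw [walsh_eq_sum_sgn, ← Finset.sum_neg_distrib]
      refine Fintype.sum_equiv (Equiv.addRight w) _ _ fun v => ?_
      have : Tr (a * F (v + w)) + Tr (ω * (v + w)) = (Tr (a * F v) + Tr (ω * v)) + 1 := by
        rw [hB, hw, mul_add, map_add, ← hω]
        ring
      simp only [Equiv.coe_addRight, this, sgn_add]
      simp [sgn]
    have : (0 : ℤ) < 2 ^ m := by positivity
    rcases hbent ω with h | h <;> omega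
  · intro hrad ω
    have hsq : walsh F a ω * walsh F a ω = 2 ^ m * 2 ^ m := by
      have e1 : walsh F a ω * walsh F a ω =
          ∑ w, ∑ v, sgn (Tr (a * F w) + Tr (ω * w)) * sgn (B v w) := by
        rw [walsh_eq_sum_sgn, Finset.sum_mul_sum, Finset.sum_comm (f := fun w v =>
          sgn (Tr (a * F w) + Tr (ω * w)) * sgn (B v w))]
        refine Finset.sum_congr rfl fun v _ => ?_
        refine (Fintype.sum_equiv (Equiv.addLeft v) _ _ fun w => ?_).symm
        rw [← sgn_add, ← sgn_add, Equiv.coe_addLeft, hB, mul_add, map_add]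
        congr 1
        generalize Tr (a * F v) = x
        generalize Tr (ω * v) = y
        generalize Tr (a * F w) = z
        generalize Tr (ω * w) = t
        generalize B v w = u
        revert x y z t u
        decide
      have e2 : ∀ w ≠ 0, ∑ v, sgn (B v w) = 0 := by
        intro w hw
        refine sum_sgn_eq_zero (B.flip w).toAddMonoidHom fun h => hw (hrad w fun v => ?_)
        exact DFunLike.congr_fun h v
      simp only [← Finset.mul_sum] at e1
      rw [e1, Finset.sum_eq_single 0 (fun w _ hw => by rw [e2 w hw, mul_zero]) (by simp)]
      have hF0 : Tr (a * F 0) = 0 := by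
        have := hB 0 0
        rw [add_zero, map_zero, add_zero] at this
        exact (show ∀ c : ZMod 2, c = c + c → c = 0 by decide) _ this
      simp only [hF0, mul_zero, map_zero, add_zero, sgn, if_true, one_mul, Finset.sum_const,
        Finset.card_univ, hcard, nsmul_eq_mul, mul_one]
      push_cast
      ring
    exact mul_self_eq_mul_self_iff.1 hsq

end Bent

section Frobenius

lemma finrank_eq_of_card {K : Type*} [Field K] [Fintype K] [Algebra (ZMod 2) K] {n : ℕ}
    (hcard : Fintype.card K = 2 ^ n) : Module.finrank (ZMod 2) K = n := by
  have h := Module.card_eq_pow_finrank (K := ZMod 2) (V := K)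
  rw [hcard, ZMod.card] at h
  exact (Nat.pow_right_injective le_rfl h).symm

variable {K : Type*} [Field K] [CharP K 2] {n : ℕ}

/-- The `k`-th power of the Frobenius map `x ↦ x²`, for `k` modulo `n`. -/
noncomputable def frobPow (K : Type*) [Field K] [CharP K 2] {n : ℕ} (k : ZMod n) : K →+* K :=
  iterateFrobenius K 2 k.val

lemma frobPow_apply (k : ZMod n) (x : K) : frobPow K k x = x ^ 2 ^ k.val :=
  iterateFrobenius_def 2 k.val x

lemma frobPow_natCast [Fintype K] (hcard : Fintype.card K = 2 ^ n) (i : ℕ) (x : K) :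
    frobPow K (i : ZMod n) x = x ^ 2 ^ i := by
  rw [frobPow_apply, ZMod.val_natCast]
  conv_rhs => rw [← Nat.mod_add_div i n, pow_add, pow_mul]
  generalize x ^ 2 ^ (i % n) = y
  rw [pow_mul, ← hcard, FiniteField.pow_card_pow]

lemma frobPow_frobPow [Fintype K] [NeZero n] (hcard : Fintype.card K = 2 ^ n) (j k : ZMod n)
    (x : K) : frobPow K j (frobPow K k x) = frobPow K (j + k) x := by
  have : j + k = ((k.val + j.val : ℕ) : ZMod n) := by
    rw [Nat.cast_add, ZMod.natCast_zmod_val, ZMod.natCast_zmod_val, add_comm]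
  rw [this, frobPow_natCast hcard, frobPow_apply, frobPow_apply, ← pow_mul, ← pow_add]

lemma frobPow_zero (x : K) : frobPow K (0 : ZMod n) x = x := by
  rw [frobPow_apply, ZMod.val_zero, pow_zero, pow_one]

variable [Fintype K] [Algebra (ZMod 2) K]

lemma algebraMap_trace_eq_sum_frobPow [NeZero n] (hcard : Fintype.card K = 2 ^ n) (x : K) :
    algebraMap (ZMod 2) K (Algebra.trace (ZMod 2) K x) = ∑ k : ZMod n, frobPow K k x := by
  rw [FiniteField.algebraMap_trace_eq_sum_pow, finrank_eq_of_card hcard]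
  simp only [Nat.card_eq_fintype_card, ZMod.card]
  refine Finset.sum_bij (fun i _ => (i : ZMod n)) (by simp) ?_ ?_ ?_
  · intro a ha b hb h
    rw [ZMod.natCast_eq_natCast_iff'] at h
    rwa [Nat.mod_eq_of_lt (by simpa using ha), Nat.mod_eq_of_lt (by simpa using hb)] at h
  · intro k _
    exact ⟨k.val, by simpa using ZMod.val_lt k, ZMod.natCast_zmod_val k⟩
  · intro i _
    rw [frobPow_natCast hcard]

lemma trace_frobPow [NeZero n] (hcard : Fintype.card K = 2 ^ n) (j : ZMod n) (x : K) :
    Algebra.trace (ZMod 2) K (frobPow K j x) = Algebra.trace (ZMod 2) K x := by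
  apply (algebraMap (ZMod 2) K).injective
  rw [algebraMap_trace_eq_sum_frobPow hcard, algebraMap_trace_eq_sum_frobPow hcard]
  simp only [frobPow_frobPow hcard]
  exact Fintype.sum_equiv (Equiv.addRight j) _ _ fun k => rfl

end Frobenius

lemma eq_zero_of_digits_sum_eq_zero (d : ℕ) (h : (Nat.digits 2 d).sum = 0) : d = 0 := by
  induction d using Nat.strong_induction_on with
  | _ d ih =>
    rcases Nat.eq_zero_or_pos d with rfl | hd
    · rfl
    · rw [Nat.digits_def' one_lt_two hd, List.sum_cons] at h
      have := ih (d / 2) (by omega) (by omega)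
      omega

lemma exists_eq_two_pow_of_digits_sum_eq_one (d : ℕ) (h : (Nat.digits 2 d).sum = 1) :
    ∃ p, d = 2 ^ p := by
  induction d using Nat.strong_induction_on with
  | _ d ih =>
    rcases Nat.eq_zero_or_pos d with rfl | hd
    · simp at h
    · rw [Nat.digits_def' one_lt_two hd, List.sum_cons] at h
      rcases Nat.mod_two_eq_zero_or_one d with h2 | h2
      · obtain ⟨p, hp⟩ := ih (d / 2) (by omega) (by omega)
        exact ⟨p + 1, by rw [pow_succ]; omega⟩
      · have := eq_zero_of_digits_sum_eq_zero (d / 2) (by omega)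
        exact ⟨0, by omega⟩

lemma exists_eq_two_pow_add_two_pow_of_digits_sum_eq_two (d : ℕ)
    (h : (Nat.digits 2 d).sum = 2) : ∃ p q, p < q ∧ d = 2 ^ p + 2 ^ q := by
  induction d using Nat.strong_induction_on with
  | _ d ih =>
    rcases Nat.eq_zero_or_pos d with rfl | hd
    · simp at h
    · rw [Nat.digits_def' one_lt_two hd, List.sum_cons] at h
      rcases Nat.mod_two_eq_zero_or_one d with h2 | h2
      · obtain ⟨p, q, hpq, hd⟩ := ih (d / 2) (by omega) (by omega)
        exact ⟨p + 1, q + 1, by omega, by rw [pow_succ, pow_succ]; omega⟩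
      · obtain ⟨q, hq⟩ := exists_eq_two_pow_of_digits_sum_eq_one (d / 2) (by omega)
        exact ⟨0, q + 1, by omega, by rw [pow_succ, pow_zero]; omega⟩

/-- An exponent of binary weight `2` is a sum of two distinct powers of `2` below `2 ^ n`. -/
lemma exists_eq_two_pow_add_of_wt2_eq_two {n N d : ℕ} (hN : N = 2 ^ n - 1) (hd : 1 ≤ d)
    (hd' : d ≤ N - 1) (hw : wt2 N (d : ℤ) = 2) : ∃ p q, p < q ∧ q < n ∧ d = 2 ^ p + 2 ^ q := by
  have hmod : ((d : ℤ) % (N : ℤ)).toNat = d := by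
    rw [← Int.natCast_mod, Int.toNat_natCast, Nat.mod_eq_of_lt (by omega)]
  rw [wt2, hmod] at hw
  obtain ⟨p, q, hpq, rfl⟩ := exists_eq_two_pow_add_two_pow_of_digits_sum_eq_two d hw
  refine ⟨p, q, hpq, ?_, rfl⟩
  have hp : 0 < 2 ^ p := by positivity
  have : 2 ^ q < 2 ^ n := by omega
  exact (Nat.pow_lt_pow_iff_right one_lt_two).1 this

section Subfields

variable {K : Type*} [Field K] [Fintype K]

lemma card_filter_pow_eq_self_le [DecidableEq K] {q : ℕ} (hq : 1 < q) :
    #{x : K | x ^ q = x} ≤ q := by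
  classical
  have h : ({x : K | x ^ q = x} : Finset K) ⊆
      (Polynomial.X ^ q - Polynomial.X : Polynomial K).roots.toFinset := by
    intro x hx
    rw [Multiset.mem_toFinset, Polynomial.mem_roots (FiniteField.X_pow_card_sub_X_ne_zero K hq)]
    simpa [sub_eq_zero] using hx
  refine (Finset.card_le_card h).trans ((Multiset.toFinset_card_le _).trans ?_)
  refine (Polynomial.card_roots' _).trans ?_
  rw [FiniteField.X_pow_card_sub_X_natDegree_eq K hq]

/-- An element not generating a field of order `2 ^ n` lies in a proper subfield. -/
lemma exists_pow_eq_self_of_closure_ne_top [CharP K 2] {n : ℕ} (hcard : Fintype.card K = 2 ^ n)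
    {γ : K} (h : Subfield.closure {γ} ≠ ⊤) :
    ∃ d e : ℕ, 0 < d ∧ 2 ≤ e ∧ d * e = n ∧ γ ^ 2 ^ d = γ := by
  classical
  set L := Subfield.closure {γ} with hL
  obtain ⟨d, -, hd⟩ := FiniteField.card L 2
  have hKL := Module.card_eq_pow_finrank (K := L) (V := K)
  rw [hcard, hd, ← pow_mul] at hKL
  refine ⟨d, Module.finrank L K, d.pos, ?_, (Nat.pow_right_injective le_rfl hKL).symm, ?_⟩
  · have h0 : 0 < Module.finrank L K := Module.finrank_pos
    by_contra hlt
    have h1 : Module.finrank L K = 1 := by omega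
    apply h
    rw [h1, mul_one, ← hd, ← hcard] at hKL
    have hb := (Fintype.bijective_iff_injective_and_card (Subtype.val : L → K)).2
      ⟨Subtype.val_injective, hKL.symm⟩
    refine eq_top_iff.2 fun x _ => ?_
    obtain ⟨y, rfl⟩ := hb.2 x
    exact y.2
  · have hγ : γ ∈ L := Subfield.subset_closure rfl
    have := FiniteField.pow_card (⟨γ, hγ⟩ : L)
    rw [hd] at this
    exact congrArg Subtype.val this

lemma sum_two_pow_sub_two (f : ℕ) :
    ∑ d ∈ Icc 2 (f + 1), (2 ^ d - 2) + 2 * (f + 1) + 2 = 2 ^ (f + 2) := by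
  induction f with
  | zero => simp
  | succ f ih =>
    rw [Finset.sum_Icc_succ_top (by omega)]
    have h1 : 2 ^ (f + 1 + 2) = 2 * 2 ^ (f + 2) := by ring
    have h2 : 2 ^ (f + 1 + 1) = 2 ^ (f + 2) := rfl
    have h3 : 2 ≤ 2 ^ (f + 2) := by
      calc 2 = 2 ^ 1 := rfl
        _ ≤ _ := Nat.pow_le_pow_right (by omega) (by omega)
    omega

lemma two_mul_sum_two_pow_sub_two_lt {m : ℕ} (hm : 0 < m) :
    2 * ∑ d ∈ Icc 2 (2 * m / 3), (2 ^ d - 2) < 2 ^ m := by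
  rcases Nat.lt_or_ge m 6 with h6 | h6
  · interval_cases m <;> decide
  · obtain ⟨f, hf⟩ : ∃ f, 2 * m / 3 = f + 1 := ⟨2 * m / 3 - 1, by omega⟩
    have h1 := sum_two_pow_sub_two f
    have h2 : 2 ^ (f + 3) ≤ 2 ^ m := Nat.pow_le_pow_right (by omega) (by omega)
    have h3 : 2 ^ (f + 3) = 2 * 2 ^ (f + 2) := by ring
    rw [hf]
    omega

end Subfields

section NonBent

variable {K : Type*} [Field K] [Fintype K] [Algebra (ZMod 2) K] [CharP K 2]

lemma trace_sq {n : ℕ} [NeZero n] (hcard : Fintype.card K = 2 ^ n) (x : K) :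
    Algebra.trace (ZMod 2) K (x ^ 2) = Algebra.trace (ZMod 2) K x := by
  rw [← trace_frobPow hcard 1 x, ← Nat.cast_one, frobPow_natCast hcard, pow_one]

lemma not_isBent_sq {m n : ℕ} [NeZero n] (hcard : Fintype.card K = 2 ^ n) {F : K → K}
    (hF : ∀ v, F (v ^ 2) = F v ^ 2) {a : K} (ha : ¬ IsBent m F a) : ¬ IsBent m F (a ^ 2) := by
  refine fun h => ha fun ω => ?_
  have : walsh F (a ^ 2) (ω ^ 2) = walsh F a ω := by
    rw [walsh_eq_sum_sgn, walsh_eq_sum_sgn]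
    refine (Fintype.sum_equiv (frobeniusEquiv K 2).toEquiv _ _ fun v => ?_).symm
    have hv : (frobeniusEquiv K 2).toEquiv v = v ^ 2 := rfl
    rw [hv, hF, ← mul_pow, ← mul_pow, trace_sq hcard, trace_sq hcard]
  exact this ▸ h (ω ^ 2)

lemma not_isBent_iff_pow_eq_self {m n : ℕ} (hm : 0 < m) (hn : n = 2 * m)
    (hcard : Fintype.card K = 2 ^ n) {F : K → K} (hF : ∀ v, F (v ^ 2) = F v ^ 2)
    (hell : ∀ γ : K, Subfield.closure {γ} = ⊤ →
      m < Module.finrank (ZMod 2) (frobSpan K γ))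
    (hSF : Set.ncard {a : K | ¬ IsBent m F a} = 2 ^ m) (a : K) :
    ¬ IsBent m F a ↔ a ^ 2 ^ m = a := by
  classical
  have : NeZero n := ⟨by omega⟩
  have hcard' : Fintype.card K = 2 ^ (2 * m) := hn ▸ hcard
  have h2m : 1 < 2 ^ m := Nat.one_lt_two_pow (by omega)
  have h0 : ¬ IsBent m F 0 := by
    intro h
    have h2 : walsh F (0 : K) 0 = 2 ^ (2 * m) := by simp [walsh_eq_sum_sgn, sgn, hcard']
    have h3 : (2 : ℤ) ^ (2 * m) = 2 ^ m * 2 ^ m := by ring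
    have h4 : (1 : ℤ) < 2 ^ m := by exact_mod_cast h2m
    rcases h 0 with h | h <;> nlinarith
  have hadd : ∀ u v, ¬ IsBent m F u → ¬ IsBent m F v → ¬ IsBent m F (u + v) := by
    intro u v hu hv
    refine add_mem_of_blocking (S := {a : K | ¬ IsBent m F a}) hm
      (by rw [Nat.card_eq_fintype_card, hcard']) hSF h0 (fun T hT => ?_) hu hv
    exact exists_not_isBent_of_finrank hm hcard' F T hT
  let S : Submodule (ZMod 2) K :=
    AddSubgroup.toZModSubmodule 2
      { carrier := {a | ¬ IsBent m F a}
        zero_mem' := h0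
        add_mem' := fun {u v} hu hv => hadd u v hu hv
        neg_mem' := fun {u} hu => by rwa [CharTwo.neg_eq] }
  have hmemS : ∀ a, a ∈ S ↔ ¬ IsBent m F a := fun a => Iff.rfl
  have hScard : Nat.card S = 2 ^ m := by
    rw [← hSF]; rfl
  have hSrank : Module.finrank (ZMod 2) S = m := by
    have h := Module.card_eq_pow_finrank (K := ZMod 2) (V := S)
    rw [← Nat.card_eq_fintype_card, hScard, ZMod.card] at h
    exact (Nat.pow_right_injective le_rfl h).symm
  have hsub : ∀ γ, ¬ IsBent m F γ → ∃ d e : ℕ, 0 < d ∧ 2 ≤ e ∧ d * e = n ∧ γ ^ 2 ^ d = γ := by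
    intro γ hγ
    refine exists_pow_eq_self_of_closure_ne_top hcard fun htop => ?_
    have hle : frobSpan K γ ≤ S := by
      refine Submodule.span_le.2 ?_
      rintro _ ⟨i, rfl⟩
      induction i with
      | zero => simpa [hmemS] using hγ
      | succ i ih =>
        have := not_isBent_sq hcard hF ih
        rwa [← pow_mul, ← pow_succ] at this
    have := Submodule.finrank_mono hle
    have := hell γ htop
    omega
  set P : Finset K := {a : K | ¬ IsBent m F a} with hP
  set E : Finset K := {a : K | a ^ 2 ^ m = a} with hE
  have hPcard : #P = 2 ^ m := by
    rw [← hSF, ← Set.ncard_coe_finset]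
    simp [hP]
  have hdiff : #(P \ E) ≤ ∑ d ∈ Icc 2 (2 * m / 3), (2 ^ d - 2) := by
    have hss : P \ E ⊆ (Icc 2 (2 * m / 3)).biUnion fun d =>
        (({x : K | x ^ 2 ^ d = x} : Finset K) \ {0, 1}) := by
      intro γ hγ
      obtain ⟨hγP, hγE⟩ := Finset.mem_sdiff.1 hγ
      obtain ⟨d, e, hd, he, hde, hγd⟩ := hsub γ (by simpa [hP] using hγP)
      have hγE' : γ ^ 2 ^ m ≠ γ := by simpa [hE] using hγE
      have hγ0 : γ ≠ 0 := by rintro rfl; exact hγE' (zero_pow (by positivity))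
      have hγ1 : γ ≠ 1 := by rintro rfl; exact hγE' (one_pow _)
      have hd1 : d ≠ 1 := by
        rintro rfl
        have : γ * (γ - 1) = 0 := by linear_combination hγd
        rcases mul_eq_zero.1 this with h | h
        · exact hγ0 h
        · exact hγ1 (sub_eq_zero.1 h)
      have he2 : e ≠ 2 := by
        rintro rfl
        have : d = m := by omega
        exact hγE' (this ▸ hγd)
      have hd3 : d * 3 ≤ 2 * m := by
        rw [← hn, ← hde]
        exact Nat.mul_le_mul_left _ (by omega)
      rw [Finset.mem_biUnion]
      exact ⟨d, by rw [Finset.mem_Icc]; omega, by simp [hγd, hγ0, hγ1]⟩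
    refine (Finset.card_le_card hss).trans (Finset.card_biUnion_le.trans ?_)
    refine Finset.sum_le_sum fun d hd => ?_
    have hd0 : d ≠ 0 := by have := (Finset.mem_Icc.1 hd).1; omega
    rw [Finset.card_sdiff_of_subset (by
      intro x hx
      rcases Finset.mem_insert.1 hx with rfl | hx
      · simp
      · rw [Finset.mem_singleton.1 hx]; simp), Finset.card_pair zero_ne_one]
    exact Nat.sub_le_sub_right (card_filter_pow_eq_self_le (Nat.one_lt_two_pow hd0)) 2
  have hPE : P ⊆ E := by
    by_contra hnot
    obtain ⟨x, hxP, hxE⟩ := Finset.not_subset.1 hnot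
    have h1 : #(P ∩ E) ≤ #(P \ E) := by
      refine Finset.card_le_card_of_injOn (fun y => y + x) (fun y hy => ?_)
        (fun _ _ _ _ h => add_right_cancel h)
      obtain ⟨hyP, hyE⟩ := Finset.mem_inter.1 hy
      simp only [hP, hE, Finset.mem_filter, Finset.mem_univ, true_and] at hxP hxE hyP hyE
      refine Finset.mem_coe.2 (Finset.mem_sdiff.2 ⟨?_, fun h => hxE ?_⟩)
      · simpa [hP] using hadd y x hyP hxP
      · simp only [hE, Finset.mem_filter, Finset.mem_univ, true_and] at h
        rw [add_pow_char_pow, hyE] at h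
        exact add_left_cancel h
    have h2 := Finset.card_inter_add_card_sdiff P E
    have h3 := two_mul_sum_two_pow_sub_two_lt hm
    omega
  have hPE' : P = E := Finset.eq_of_subset_of_card_le hPE
    ((card_filter_pow_eq_self_le h2m).trans hPcard.ge)
  have := Finset.ext_iff.1 hPE' a
  simpa [hP, hE] using this

end NonBent

section Polar

variable {K : Type*} [Field K] [CharP K 2] {n : ℕ}

/-- Distinct powers of the Frobenius map are linearly independent. -/
lemma eq_zero_of_sum_mul_frobPow [Fintype K] [NeZero n] (hcard : Fintype.card K = 2 ^ n)
    (c : ZMod n → K) (hc : ∀ x, ∑ k, c k * frobPow K k x = 0) : c = 0 := by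
  have hinj : Function.Injective fun k : ZMod n => (frobPow K k : K →* K) := by
    classical
    intro j k hjk
    by_contra hne
    have hval : (j - k).val ≠ 0 := by rwa [Ne, ZMod.val_eq_zero, sub_eq_zero]
    have hfix : ∀ x : K, x ^ 2 ^ (j - k).val = x := by
      intro x
      rw [← frobPow_apply, sub_eq_add_neg, ← frobPow_frobPow hcard]
      have h := DFunLike.congr_fun hjk (frobPow K (-k) x)
      simp only [MonoidHom.coe_coe] at h
      rw [h, frobPow_frobPow hcard, add_neg_cancel, frobPow_zero]
    have h1 := card_filter_pow_eq_self_le (K := K) (Nat.one_lt_two_pow hval)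
    rw [Finset.filter_true_of_mem fun x _ => hfix x, Finset.card_univ, hcard] at h1
    exact absurd h1 (not_le.2 (Nat.pow_lt_pow_right one_lt_two (ZMod.val_lt _)))
  have hli := (linearIndependent_monoidHom K K).comp _ hinj
  rw [Fintype.linearIndependent_iff] at hli
  refine funext fun k => hli c (funext fun x => ?_) k
  simpa using hc x

lemma frobPow_injective [Fintype K] [NeZero n] (hcard : Fintype.card K = 2 ^ n) {j k : ZMod n}
    (h : ∀ x : K, frobPow K j x = frobPow K k x) : j = k := by
  by_contra hne
  have := eq_zero_of_sum_mul_frobPow hcard (Pi.single j 1 + Pi.single k 1 : ZMod n → K)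
    fun x => by
      simp [add_mul, Finset.sum_add_distrib, Pi.single_apply, h, CharTwo.add_self_eq_zero]
  simpa [hne] using congrFun this j

lemma exists_add_frobPow_half_eq_one [Fintype K] [NeZero n] {m : ℕ} (hm : 0 < m) (hn : n = 2 * m)
    (hcard : Fintype.card K = 2 ^ n) : ∃ δ : K, frobPow K (m : ZMod n) δ = δ + 1 := by
  obtain ⟨a, ha⟩ : ∃ a : K, frobPow K (m : ZMod n) a ≠ a := by
    by_contra! h
    exact half_ne_zero hm hn
      (frobPow_injective (K := K) hcard fun x => by rw [h, frobPow_zero])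
  have h0 : a + frobPow K (m : ZMod n) a ≠ 0 := fun h => ha (CharTwo.add_eq_zero.1 h).symm
  refine ⟨a / (a + frobPow K (m : ZMod n) a), ?_⟩
  have hd : frobPow K (m : ZMod n) (a + frobPow K (m : ZMod n) a) =
      a + frobPow K (m : ZMod n) a := by
    rw [map_add, frobPow_frobPow hcard, half_add_half hn, frobPow_zero, add_comm]
  rw [map_div₀, hd, div_add_one h0, ← add_assoc, CharTwo.add_self_eq_zero, zero_add]

/-- The polar form of `x ↦ x ^ (2 ^ p + 2 ^ q) + x ^ (2 ^ p' + 2 ^ q')`. -/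
noncomputable def polar (p q p' q' : ZMod n) (x y : K) : K :=
  frobPow K p x * frobPow K q y + frobPow K q x * frobPow K p y +
    (frobPow K p' x * frobPow K q' y + frobPow K q' x * frobPow K p' y)

/-- The components of the polar form which are degenerate are those of index in the subfield fixed
by the `m`-th power of the Frobenius map. -/
def DegenerateOnSubfield (K : Type*) [Field K] [CharP K 2] [Algebra (ZMod 2) K] {n : ℕ} (m : ℕ)
    (p q p' q' : ZMod n) : Prop :=
  ∀ a : K, (∃ w ≠ 0, ∀ v, Algebra.trace (ZMod 2) K (a * polar p q p' q' v w) = 0) ↔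
    frobPow K (m : ZMod n) a = a

variable [Algebra (ZMod 2) K] {m : ℕ} {p q p' q' : ZMod n}

/-- A component of the polar form, as a bilinear form over the prime field. -/
noncomputable def polarForm (p q p' q' : ZMod n) (a : K) : LinearMap.BilinForm (ZMod 2) K :=
  LinearMap.mk₂ (ZMod 2) (fun x y => Algebra.trace (ZMod 2) K (a * polar p q p' q' x y))
    (fun x x' y => by rw [← map_add]; congr 1; simp only [polar, map_add]; ring)
    (fun c x y => by
      rcases (show ∀ c : ZMod 2, c = 0 ∨ c = 1 by decide) c with rfl | rfl <;> simp [polar])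
    (fun x y y' => by rw [← map_add]; congr 1; simp only [polar, map_add]; ring)
    (fun c x y => by
      rcases (show ∀ c : ZMod 2, c = 0 ∨ c = 1 by decide) c with rfl | rfl <;> simp [polar])

lemma polarForm_apply (a x y : K) : polarForm p q p' q' a x y =
    Algebra.trace (ZMod 2) K (a * polar p q p' q' x y) := rfl

lemma DegenerateOnSubfield.swap_left (h : DegenerateOnSubfield K m p q p' q') :
    DegenerateOnSubfield K m q p p' q' := by
  intro a
  rw [← h a]
  simp only [polar, add_comm]

lemma DegenerateOnSubfield.swap (h : DegenerateOnSubfield K m p q p' q') :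
    DegenerateOnSubfield K m p' q' p q := by
  intro a
  rw [← h a]
  simp only [polar, add_comm]

lemma DegenerateOnSubfield.swap_right (h : DegenerateOnSubfield K m p q p' q') :
    DegenerateOnSubfield K m p q q' p' :=
  h.swap.swap_left.swap

variable [Fintype K]

lemma DegenerateOnSubfield.of_isBent [NeZero n] (hn : n = 2 * m)
    (hcard : Fintype.card K = 2 ^ n) {F : K → K}
    (hF : ∀ x, F x = frobPow K p x * frobPow K q x + frobPow K p' x * frobPow K q' x)
    (hS : ∀ a, ¬ IsBent m F a ↔ a ^ 2 ^ m = a) : DegenerateOnSubfield K m p q p' q' := by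
  intro a
  have hB : ∀ x y, Algebra.trace (ZMod 2) K (a * F (x + y)) =
      Algebra.trace (ZMod 2) K (a * F x) + Algebra.trace (ZMod 2) K (a * F y) +
        polarForm p q p' q' a x y := by
    intro x y
    rw [polarForm_apply, ← map_add, ← map_add]
    congr 1
    simp only [hF, polar, map_add]
    ring
  rw [frobPow_natCast hcard, ← hS a, isBent_iff_radical (hn ▸ hcard) F a _ hB]
  simp only [polarForm_apply]
  push Not
  exact ⟨fun ⟨w, hw, h⟩ => ⟨w, h, hw⟩, fun ⟨w, h, hw⟩ => ⟨w, hw, h⟩⟩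


/-- Moving the argument of the polar form across the trace. -/
lemma trace_mul_polar [NeZero n] (hcard : Fintype.card K = 2 ^ n) (a v w : K) :
    Algebra.trace (ZMod 2) K (a * polar p q p' q' v w) = Algebra.trace (ZMod 2) K
      (v * (frobPow K (-p) a * frobPow K (q - p) w + frobPow K (-q) a * frobPow K (p - q) w +
        (frobPow K (-p') a * frobPow K (q' - p') w +
          frobPow K (-q') a * frobPow K (p' - q') w))) := by
  have key : ∀ i j : ZMod n, Algebra.trace (ZMod 2) K (a * (frobPow K i v * frobPow K j w)) =
      Algebra.trace (ZMod 2) K (v * (frobPow K (-i) a * frobPow K (j - i) w)) := by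
    intro i j
    rw [← trace_frobPow hcard (-i)]
    simp only [map_mul, frobPow_frobPow hcard, neg_add_cancel, frobPow_zero]
    rw [neg_add_eq_sub]
    congr 1
    ring
  simp only [polar, mul_add, map_add, key]

lemma DegenerateOnSubfield.frobPow_half_eq_of_sum_eq_zero [NeZero n]
    (h : DegenerateOnSubfield K m p q p' q') (hcard : Fintype.card K = 2 ^ n) {a : K}
    (ha : frobPow K (-p) a + frobPow K (-q) a + (frobPow K (-p') a + frobPow K (-q') a) = 0) :
    frobPow K (m : ZMod n) a = a := by
  refine (h a).1 ⟨1, one_ne_zero, fun v => ?_⟩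
  rw [trace_mul_polar hcard]
  simp only [map_one, mul_one, ha, mul_zero, map_zero]

lemma DegenerateOnSubfield.exclusions [NeZero n] (hm : 0 < m) (hn : n = 2 * m)
    (h : DegenerateOnSubfield K m p q p' q') (hcard : Fintype.card K = 2 ^ n) :
    ¬ (p' = p ∧ q' = q) ∧ ¬ (p' = p + m ∧ q' = q + m) ∧ ¬ (q = p + m ∧ q' = p' + m) := by
  obtain ⟨δ, hδ⟩ := exists_add_frobPow_half_eq_one (K := K) hm hn hcard
  have hne : frobPow K (m : ZMod n) δ ≠ δ := by rw [hδ]; simp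
  have hneg : -(m : ZMod n) = m := neg_eq_of_add_eq_zero_left (half_add_half hn)
  have hshift : ∀ k : ZMod n, frobPow K (-(k + (m : ZMod n))) δ = frobPow K (-k) δ + 1 := by
    intro k
    rw [neg_add, hneg, ← frobPow_frobPow hcard, hδ, map_add, map_one]
  have h2 : (2 : K) = 0 := CharTwo.two_eq_zero
  refine ⟨?_, ?_, ?_⟩ <;> rintro ⟨rfl, rfl⟩ <;>
    refine hne (h.frobPow_half_eq_of_sum_eq_zero hcard ?_)
  · linear_combination (frobPow K (-p') δ + frobPow K (-q') δ) * h2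
  · rw [hshift, hshift]
    linear_combination (frobPow K (-p) δ + frobPow K (-q) δ + 1) * h2
  · rw [hshift, hshift]
    linear_combination (frobPow K (-p) δ + frobPow K (-p') δ + 1) * h2

/-- Every nonzero vector lies in the radical of some nonzero component of the polar form. -/
lemma exists_ne_zero_forall_trace_mul_polar_eq_zero [NeZero n]
    (hcard : Fintype.card K = 2 ^ n) (p q p' q' : ZMod n) {x : K} (hx : x ≠ 0) :
    ∃ c ≠ 0, frobPow K (-p) c * frobPow K (q - p) x + frobPow K (-q) c * frobPow K (p - q) x +
        (frobPow K (-p') c * frobPow K (q' - p') x +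
          frobPow K (-q') c * frobPow K (p' - q') x) = 0 := by
  let L : K →+ K :=
    { toFun := fun c => frobPow K (-p) c * frobPow K (q - p) x +
        frobPow K (-q) c * frobPow K (p - q) x + (frobPow K (-p') c * frobPow K (q' - p') x +
          frobPow K (-q') c * frobPow K (p' - q') x)
      map_zero' := by simp
      map_add' := fun c c' => by simp only [map_add]; ring }
  by_contra! hL
  have hinj : Function.Injective L := by
    rw [injective_iff_map_eq_zero]
    intro c hc
    by_contra hc0
    exact hL c hc0 hc
  obtain ⟨z, hz⟩ := exists_trace_mul_ne_zero hx
  obtain ⟨c, rfl⟩ := Finite.surjective_of_injective hinj z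
  apply hz
  have := trace_mul_polar (p := p) (q := q) (p' := p') (q' := q') hcard c x x
  refine this.symm.trans ?_
  have h0 : polar p q p' q' x x = 0 := by
    rw [polar]
    linear_combination (frobPow K p x * frobPow K q x +
      frobPow K p' x * frobPow K q' x) * (CharTwo.two_eq_zero : (2 : K) = 0)
  rw [h0, mul_zero, map_zero]

lemma DegenerateOnSubfield.ne_add_half [NeZero n] (hm : 0 < m) (hn : n = 2 * m)
    (h : DegenerateOnSubfield K m p q p' q') (hcard : Fintype.card K = 2 ^ n) (hpq' : q' ≠ p') :
    q ≠ p + m := by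
  intro hq
  have hq' : q' - p' ≠ m := fun h' =>
    (h.exclusions hm hn hcard).2.2 ⟨hq, by rw [← h']; ring⟩
  have hneg : -(m : ZMod n) = m := neg_eq_of_add_eq_zero_left (half_add_half hn)
  set r := q' - p' with hr
  have hr0 : r ≠ 0 := sub_ne_zero.2 hpq'
  have h2r : r ≠ -r := by
    intro h2
    rcases eq_zero_or_half (b := r) hm hn (by linear_combination h2) with h3 | h3
    · exact hr0 h3
    · exact hq' h3
  have h2 : (2 : K) = 0 := CharTwo.two_eq_zero
  have key : ∀ x : K, frobPow K r x * frobPow K ((m : ZMod n) - r) x =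
      frobPow K (-r) x * frobPow K ((m : ZMod n) + r) x := by
    intro x
    rcases eq_or_ne x 0 with rfl | hx
    · simp
    obtain ⟨c, hc0, hc⟩ := exists_ne_zero_forall_trace_mul_polar_eq_zero hcard p q p' q' hx
    have hcE : frobPow K (m : ZMod n) c = c := by
      refine (h c).1 ⟨x, hx, fun v => ?_⟩
      rw [trace_mul_polar hcard, hc, mul_zero, map_zero]
    have hcq : frobPow K (-q) c = frobPow K (-p) c := by
      rw [hq, neg_add, hneg, ← frobPow_frobPow hcard, hcE]
    have hqp : q - p = m := by rw [hq]; ring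
    have hpq : p - q = m := by linear_combination -hq + hneg
    have hpr : p' - q' = -r := by rw [hr]; ring
    rw [hcq, hqp, hpq, hpr] at hc
    have e1 : frobPow K (-p') c * frobPow K r x = frobPow K (-q') c * frobPow K (-r) x := by
      linear_combination hc - (frobPow K (-p) c * frobPow K (m : ZMod n) x +
        frobPow K (-q') c * frobPow K (-r) x) * h2
    have e2 := congrArg (frobPow K (m : ZMod n)) e1
    have hcm : ∀ k : ZMod n, frobPow K ((m : ZMod n) + k) c = frobPow K k c := by
      intro k
      rw [add_comm, ← frobPow_frobPow hcard, hcE]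
    simp only [map_mul, frobPow_frobPow hcard, hcm] at e2
    have hp0 : frobPow K (-p') c ≠ 0 := (map_ne_zero _).2 hc0
    have hq0 : frobPow K (-q') c ≠ 0 := (map_ne_zero _).2 hc0
    rw [sub_eq_add_neg]
    refine mul_left_cancel₀ (mul_ne_zero hp0 hq0) ?_
    linear_combination (frobPow K (-q') c * frobPow K ((m : ZMod n) + -r) x) * e1 -
      frobPow K (-q') c * frobPow K (-r) x * e2
  have hlin : ∀ x : K, frobPow K r x + frobPow K ((m : ZMod n) - r) x + frobPow K (-r) x +
      frobPow K ((m : ZMod n) + r) x = 0 := by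
    intro x
    have h1 := key (x + 1)
    simp only [map_add, map_one] at h1
    linear_combination h1 - key x + (frobPow K (-r) x + frobPow K ((m : ZMod n) + r) x) * h2
  have hm0 : (m : ZMod n) ≠ 0 := half_ne_zero hm hn
  by_cases h2m : r = m - r
  · have hmr : (m : ZMod n) + r = -r := by rw [← hneg]; linear_combination h2m
    refine h2r (frobPow_injective (K := K) hcard fun x => ?_)
    have h1 := key x
    rw [← h2m, hmr, ← sq, ← sq] at h1
    exact frobenius_inj K 2 h1
  · have h1 := eq_zero_of_sum_mul_frobPow hcard (Pi.single r 1 + Pi.single ((m : ZMod n) - r) 1 +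
      Pi.single (-r) 1 + Pi.single ((m : ZMod n) + r) 1 : ZMod n → K) fun x => by
        simpa [add_mul, Finset.sum_add_distrib, Pi.single_apply] using hlin x
    have h3 := congrFun h1 r
    simp [h2m, h2r, hm0] at h3

end Polar

section CharTwoDet

variable {ι : Type*} [Fintype ι] [DecidableEq ι]

/-- The fixed-point-free involutions of `ι`, i.e. its perfect matchings. -/
def matchings (ι : Type*) [Fintype ι] [DecidableEq ι] : Finset (Equiv.Perm ι) :=
  {σ | σ⁻¹ = σ ∧ ∀ i, σ i ≠ i}

/-- One endpoint of each pair of a perfect matching, chosen by the ranking `r`. -/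
def lowerHalf (r : ι → ℕ) (σ : Equiv.Perm ι) : Finset ι :=
  {i | r i < r (σ i)}

lemma apply_apply_of_mem_matchings {σ : Equiv.Perm ι} (hσ : σ ∈ matchings ι) (i : ι) :
    σ (σ i) = i := by
  have h : σ⁻¹ = σ := (Finset.mem_filter.1 hσ).2.1
  rw [← Equiv.Perm.mul_apply]
  nth_rw 1 [← h]
  rw [inv_mul_cancel, Equiv.Perm.one_apply]

lemma apply_ne_of_mem_matchings {σ : Equiv.Perm ι} (hσ : σ ∈ matchings ι) (i : ι) : σ i ≠ i :=
  (Finset.mem_filter.1 hσ).2.2 i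

lemma apply_mem_lowerHalf_iff {r : ι → ℕ} (hr : Function.Injective r) {σ : Equiv.Perm ι}
    (hσ : σ ∈ matchings ι) (i : ι) : σ i ∈ lowerHalf r σ ↔ i ∉ lowerHalf r σ := by
  have h1 : r (σ i) ≠ r i := fun h => apply_ne_of_mem_matchings hσ i (hr h)
  simp only [lowerHalf, Finset.mem_filter, Finset.mem_univ, true_and,
    apply_apply_of_mem_matchings hσ]
  omega

lemma prod_mul_prod_lowerHalf {R : Type*} [CommMonoid R] {r : ι → ℕ}
    (hr : Function.Injective r) {σ : Equiv.Perm ι} (hσ : σ ∈ matchings ι) (f : ι → R) :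
    ∏ i, f i = (∏ i ∈ lowerHalf r σ, f i) * ∏ i ∈ lowerHalf r σ, f (σ i) := by
  rw [← Finset.prod_mul_prod_compl (lowerHalf r σ)]
  congr 1
  refine (Finset.prod_equiv σ (fun i => ?_) fun i _ => rfl).symm
  rw [Finset.mem_compl, apply_mem_lowerHalf_iff hr hσ, not_not]

lemma two_mul_card_lowerHalf {r : ι → ℕ} (hr : Function.Injective r) {σ : Equiv.Perm ι}
    (hσ : σ ∈ matchings ι) : 2 * #(lowerHalf r σ) = Fintype.card ι := by
  have h : #(lowerHalf r σ)ᶜ = #(lowerHalf r σ) := by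
    refine (Finset.card_equiv σ fun i => ?_).symm
    rw [Finset.mem_compl, apply_mem_lowerHalf_iff hr hσ, not_not]
  have := Finset.card_add_card_compl (lowerHalf r σ)
  omega

/-- In characteristic two the determinant of a symmetric matrix with zero diagonal is the square
of its Pfaffian. -/
lemma det_eq_sum_matchings_sq {K : Type*} [Field K] [CharP K 2] {r : ι → ℕ}
    (hr : Function.Injective r) (M : Matrix ι ι K) (hsymm : ∀ i j, M i j = M j i)
    (hdiag : ∀ i, M i i = 0) :
    M.det = (∑ σ ∈ matchings ι, ∏ i ∈ lowerHalf r σ, M (σ i) i) ^ 2 := by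
  have hsign : ∀ σ : Equiv.Perm ι, Equiv.Perm.sign σ • ∏ i, M (σ i) i = ∏ i, M (σ i) i := by
    intro σ
    rcases Int.units_eq_one_or (Equiv.Perm.sign σ) with h | h <;> rw [h]
    · rw [one_smul]
    · rw [Units.neg_smul, one_smul, CharTwo.neg_eq]
  have hinv : ∀ σ : Equiv.Perm ι, ∏ i, M (σ⁻¹ i) i = ∏ i, M (σ i) i := by
    intro σ
    rw [← Equiv.prod_comp σ]
    refine Finset.prod_congr rfl fun i _ => ?_
    rw [← Equiv.Perm.mul_apply, inv_mul_cancel, Equiv.Perm.one_apply, hsymm]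
  rw [Matrix.det_apply, Finset.sum_congr rfl fun σ _ => hsign σ, CharTwo.sum_sq]
  have hzero : ∑ σ ∈ ({σ | σ⁻¹ ≠ σ} : Finset (Equiv.Perm ι)), ∏ i, M (σ i) i = 0 := by
    refine Finset.sum_involution (fun σ _ => σ⁻¹) ?_ ?_ ?_ ?_
    · intro σ _
      rw [hinv, CharTwo.add_self_eq_zero]
    · intro σ hσ _
      exact (Finset.mem_filter.1 hσ).2
    · intro σ hσ
      have := (Finset.mem_filter.1 hσ).2
      simpa [eq_comm] using this
    · intro σ _
      exact inv_inv σ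
  rw [← Finset.sum_filter_not_add_sum_filter (s := univ) (p := fun σ : Equiv.Perm ι => σ⁻¹ ≠ σ),
    hzero, add_zero]
  refine (Finset.sum_subset_zero_on_sdiff ?_ ?_ ?_).symm
  · intro σ hσ
    have := (Finset.mem_filter.1 hσ).2.1
    simpa using this
  · intro σ hσ
    obtain ⟨h1, h2⟩ := Finset.mem_sdiff.1 hσ
    have h1' : σ⁻¹ = σ := by simpa using h1
    have : ∃ i, σ i = i := by
      by_contra! h3
      exact h2 (Finset.mem_filter.2 ⟨Finset.mem_univ _, h1', h3⟩)
    obtain ⟨i, hi⟩ := this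
    exact Finset.prod_eq_zero (Finset.mem_univ i) (by rw [hi, hdiag])
  · intro σ hσ
    rw [prod_mul_prod_lowerHalf hr hσ, sq]
    congr 1
    refine Finset.prod_congr rfl fun i _ => ?_
    rw [apply_apply_of_mem_matchings hσ, hsymm]

end CharTwoDet

lemma sum_pow_eq_zero_of_not_dvd {K : Type*} [Field K] [Fintype K] {e : ℕ}
    (he : ¬ Fintype.card K - 1 ∣ e) : ∑ a : K, a ^ e = 0 := by
  rw [← FiniteField.forall_pow_eq_one_iff K e] at he
  push Not at he
  obtain ⟨ζ, hζ⟩ := he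
  have h : (ζ : K) ^ e * ∑ a : K, a ^ e = ∑ a : K, a ^ e := by
    rw [Finset.mul_sum]
    refine Fintype.sum_equiv ζ.mulLeft _ _ fun a => ?_
    rw [Units.mulLeft_apply, mul_pow]
  have h1 : (ζ : K) ^ e ≠ 1 := fun h1 => hζ (Units.ext (by simpa using h1))
  by_contra h0
  exact h1 (mul_right_cancel₀ h0 (by rw [h, one_mul]))

lemma exists_choice_of_sum_prod_sum_ne_zero {A ι ε R : Type*} [Fintype A] [Fintype ε]
    [Inhabited ε] [CommRing R] (s : Finset ι) (f : ι → ε → A → R) (g : A → R)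
    (h : ∑ a, (∏ i ∈ s, ∑ e, f i e a) * g a ≠ 0) :
    ∃ φ : ι → ε, ∑ a, (∏ i ∈ s, f i (φ i) a) * g a ≠ 0 := by
  classical
  induction s using Finset.induction_on generalizing g with
  | empty => exact ⟨fun _ => default, h⟩
  | insert j s hj ih =>
    have h1 : ∑ a, (∏ i ∈ insert j s, ∑ e, f i e a) * g a =
        ∑ e, ∑ a, (∏ i ∈ s, ∑ e, f i e a) * (f j e a * g a) := by
      rw [Finset.sum_comm]
      refine Finset.sum_congr rfl fun a _ => ?_
      rw [Finset.prod_insert hj, ← Finset.mul_sum, ← Finset.sum_mul]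
      ring
    rw [h1] at h
    obtain ⟨e, -, he⟩ := Finset.exists_ne_zero_of_sum_ne_zero h
    obtain ⟨φ, hφ⟩ := ih _ he
    refine ⟨Function.update φ j e, ?_⟩
    convert hφ using 2 with a
    rw [Finset.prod_insert hj, Function.update_self, Finset.prod_congr rfl fun i hi => by
      rw [Function.update_of_ne (ne_of_mem_of_not_mem hi hj)]]
    ring

section Rotation

variable {n : ℕ} [NeZero n]

lemma sum_zmod_eq_sum_range {R : Type*} [AddCommMonoid R] (f : ℕ → R) :
    ∑ k : ZMod n, f k.val = ∑ i ∈ range n, f i := by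
  refine Finset.sum_bij (fun k _ => k.val) (fun k _ => by simpa using ZMod.val_lt k)
    (fun _ _ _ _ h => ZMod.val_injective n h) (fun i hi => ?_) fun _ _ => rfl
  exact ⟨(i : ZMod n), Finset.mem_univ _, ZMod.val_cast_of_lt (Finset.mem_range.1 hi)⟩

lemma sum_two_pow_val : ∑ k : ZMod n, 2 ^ k.val = 2 ^ n - 1 := by
  rw [sum_zmod_eq_sum_range fun i => 2 ^ i, Nat.geomSum_eq le_rfl]
  simp

/-- A multiset of `n` powers of two modulo `2 ^ n - 1` whose sum vanishes consists of each power
exactly once. -/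
lemma eq_one_of_dvd_sum_two_pow (c : ZMod n → ℕ) (hc : ∑ k, c k = n)
    (hdvd : 2 ^ n - 1 ∣ ∑ k, c k * 2 ^ k.val) (k : ZMod n) : c k = 1 := by
  have hn : 0 < n := Nat.pos_of_ne_zero (NeZero.ne n)
  have hn1 : 1 ≤ n := hn
  set N := 2 ^ n - 1 with hN
  have hNpos : 0 < N := by
    have := Nat.one_lt_two_pow (NeZero.ne n)
    omega
  let S : ZMod n → ℕ := fun j => ∑ k, c k * 2 ^ (k + j).val
  have hstep : ∀ k j : ZMod n, 2 * 2 ^ (k + j).val =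
      2 ^ (k + (j + 1)).val + if k = -1 - j then N else 0 := by
    intro k j
    rw [← add_assoc]
    generalize hl : k + j = l
    have hiff : k = -1 - j ↔ l = -1 := by
      rw [← hl]
      constructor
      · rintro rfl; ring
      · intro h; rw [← h]; ring
    have hiff2 : l = -1 ↔ l.val = n - 1 := by
      have h3 : ((n - 1 : ℕ) : ZMod n) = -1 := by
        rw [Nat.cast_sub hn1]; simp
      have h4 : (-1 : ZMod n).val = n - 1 := by
        rw [← h3, ZMod.val_cast_of_lt (by omega)]
      rw [← h4]
      exact (ZMod.val_injective n).eq_iff.symm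
    have hlt := ZMod.val_lt l
    by_cases hlast : l.val = n - 1
    · rw [if_pos (hiff.2 (hiff2.2 hlast)), hiff2.2 hlast, neg_add_cancel, ZMod.val_zero,
        ← hiff2.2 hlast, hlast, pow_zero, hN, mul_comm, ← pow_succ, Nat.sub_add_cancel hn1]
      have := Nat.one_lt_two_pow (NeZero.ne n)
      omega
    · rw [if_neg (fun h => hlast (hiff2.1 (hiff.1 h)))]
      have : (l + 1).val = l.val + 1 := by
        have h5 : l + 1 = ((l.val + 1 : ℕ) : ZMod n) := by
          rw [Nat.cast_add, ZMod.natCast_zmod_val, Nat.cast_one]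
        rw [h5, ZMod.val_cast_of_lt (by omega)]
      rw [this, pow_succ]
      ring
  have hrec : ∀ j, 2 * S j = S (j + 1) + c (-1 - j) * N := by
    intro j
    simp only [S, Finset.mul_sum]
    have h6 : ∀ k, 2 * (c k * 2 ^ (k + j).val) =
        c k * 2 ^ (k + (j + 1)).val + if k = -1 - j then c k * N else 0 := by
      intro k
      rw [mul_left_comm, hstep, mul_add, mul_ite, mul_zero]
    simp only [h6, Finset.sum_add_distrib, Finset.sum_ite_eq', Finset.mem_univ, if_true]
  have hdvdS : ∀ i : ℕ, N ∣ S (i : ZMod n) := by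
    intro i
    induction i with
    | zero => simpa [S] using hdvd
    | succ i ih =>
      have h7 : N ∣ S (i + 1) + c (-1 - i) * N := hrec i ▸ ih.mul_left 2
      have := (Nat.dvd_add_left (Dvd.intro_left _ rfl)).1 h7
      simpa using this
  have hle : ∀ j, N ≤ S j := by
    intro j
    have hj : N ∣ S j := by
      have := hdvdS j.val
      rwa [ZMod.natCast_zmod_val] at this
    refine Nat.le_of_dvd ?_ hj
    have : n ≤ S j := by
      rw [← hc]
      exact Finset.sum_le_sum fun k _ => Nat.le_mul_of_pos_right _ (by positivity)
    omega
  have hsum : ∑ j, S j = ∑ _j : ZMod n, N := by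
    simp only [S]
    rw [Finset.sum_comm]
    have h8 : ∀ k : ZMod n, ∑ j : ZMod n, c k * 2 ^ (k + j).val = c k * N := by
      intro k
      rw [← Finset.mul_sum, hN, ← sum_two_pow_val]
      congr 1
      exact Fintype.sum_equiv (Equiv.addLeft k) _ _ fun _ => rfl
    rw [Finset.sum_congr rfl fun k _ => h8 k, ← Finset.sum_mul, hc]
    simp
  have heq : ∀ j, S j = N := fun j =>
    ((Finset.sum_eq_sum_iff_of_le fun j _ => hle j).1 hsum.symm j (Finset.mem_univ j)).symm
  have h9 := hrec (-1 - k)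
  rw [heq, heq, sub_sub_cancel] at h9
  have h10 : c k * N = 1 * N := by omega
  exact Nat.eq_of_mul_eq_mul_right hNpos h10

end Rotation

section PolarMatrix

variable {K : Type*} [Field K] [CharP K 2] {n : ℕ} {p q p' q' : ZMod n}

/-- The monomials of the polar form, labelled by a shift and one of the two exponents. -/
def EdgeAdj (p q p' q' : ZMod n) (e : ZMod n × Bool) (i j : ZMod n) : Prop :=
  (e.2 = true ∧ (i = e.1 + p ∧ j = e.1 + q ∨ i = e.1 + q ∧ j = e.1 + p)) ∨
    (e.2 = false ∧ (i = e.1 + p' ∧ j = e.1 + q' ∨ i = e.1 + q' ∧ j = e.1 + p'))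

lemma edgeAdj_comm {e : ZMod n × Bool} {i j : ZMod n} :
    EdgeAdj p q p' q' e i j ↔ EdgeAdj p q p' q' e j i := by
  simp only [EdgeAdj]
  tauto

variable [NeZero n]

open scoped Classical in
/-- The matrix of a component of the polar form in terms of powers of the Frobenius map. -/
noncomputable def polarMatrix (p q p' q' : ZMod n) (a : K) : Matrix (ZMod n) (ZMod n) K :=
  fun i j => ∑ e : ZMod n × Bool, if EdgeAdj p q p' q' e i j then frobPow K e.1 a else 0

lemma polarMatrix_symm (a : K) (i j : ZMod n) :
    polarMatrix p q p' q' a i j = polarMatrix p q p' q' a j i := by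
  classical
  exact Finset.sum_congr rfl fun e _ => if_congr edgeAdj_comm rfl rfl

lemma polarMatrix_diag (hpq : q ≠ p) (hpq' : q' ≠ p') (a : K) (i : ZMod n) :
    polarMatrix p q p' q' a i i = 0 := by
  refine Finset.sum_eq_zero fun e _ => if_neg ?_
  rintro (⟨-, ⟨h1, h2⟩ | ⟨h1, h2⟩⟩ | ⟨-, ⟨h1, h2⟩ | ⟨h1, h2⟩⟩)
  · exact hpq (add_left_cancel (h2.symm.trans h1))
  · exact hpq (add_left_cancel (h1.symm.trans h2))
  · exact hpq' (add_left_cancel (h2.symm.trans h1))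
  · exact hpq' (add_left_cancel (h1.symm.trans h2))

lemma sum_sum_ite_pair {ι R : Type*} [Fintype ι] [DecidableEq ι] [AddCommMonoid R] {u v : ι}
    (huv : u ≠ v) (g : ι → ι → R) :
    ∑ i, ∑ j, (if i = u ∧ j = v ∨ i = v ∧ j = u then g i j else 0) = g u v + g v u := by
  have h : ∀ i j, (if i = u ∧ j = v ∨ i = v ∧ j = u then g i j else 0) =
      (if i = u then if j = v then g i j else 0 else 0) +
        if i = v then if j = u then g i j else 0 else 0 := by
    intro i j
    by_cases h1 : i = u
    · simp [h1, huv]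
    · simp [h1, ite_and]
  simp [h, Finset.sum_add_distrib, Finset.sum_ite_irrel]

variable [Fintype K] [Algebra (ZMod 2) K]

lemma algebraMap_polarForm (hcard : Fintype.card K = 2 ^ n) (hpq : q ≠ p) (hpq' : q' ≠ p')
    (a x y : K) : algebraMap (ZMod 2) K (polarForm p q p' q' a x y) =
      ∑ i, ∑ j, frobPow K i x * polarMatrix p q p' q' a i j * frobPow K j y := by
  classical
  have hR : ∀ i j, frobPow K i x * polarMatrix p q p' q' a i j * frobPow K j y =
      ∑ k : ZMod n,
        ((if i = k + p ∧ j = k + q ∨ i = k + q ∧ j = k + p then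
            frobPow K k a * (frobPow K i x * frobPow K j y) else 0) +
          if i = k + p' ∧ j = k + q' ∨ i = k + q' ∧ j = k + p' then
            frobPow K k a * (frobPow K i x * frobPow K j y) else 0) := by
    intro i j
    rw [polarMatrix, Finset.mul_sum, Finset.sum_mul, Fintype.sum_prod_type]
    refine Finset.sum_congr rfl fun k _ => ?_
    rw [Fintype.sum_bool]
    simp only [EdgeAdj, mul_ite, ite_mul, mul_zero, zero_mul, true_and, false_and, or_false,
      false_or, reduceCtorEq]
    congr 2 <;> ring
  simp only [hR]
  rw [polarForm_apply, algebraMap_trace_eq_sum_frobPow hcard]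
  have hswap : ∀ f : ZMod n → ZMod n → ZMod n → K,
      ∑ i, ∑ j, ∑ k, f i j k = ∑ k, ∑ i, ∑ j, f i j k := by
    intro f
    rw [Finset.sum_congr rfl fun i _ => Finset.sum_comm, Finset.sum_comm]
  rw [hswap]
  refine Finset.sum_congr rfl fun k _ => ?_
  simp only [Finset.sum_add_distrib]
  rw [sum_sum_ite_pair (fun h => hpq (add_left_cancel h).symm),
    sum_sum_ite_pair (fun h => hpq' (add_left_cancel h).symm)]
  simp only [polar, map_mul, map_add, frobPow_frobPow hcard]
  ring

/-- The determinant of a component of the polar form takes a single nonzero value. -/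
lemma DegenerateOnSubfield.exists_det_polarMatrix {m : ℕ} (hm : 0 < m) (hn : n = 2 * m)
    (h : DegenerateOnSubfield K m p q p' q') (hcard : Fintype.card K = 2 ^ n) (hpq : q ≠ p)
    (hpq' : q' ≠ p') : ∃ κ : K, κ ≠ 0 ∧ ∀ a : K,
      (frobPow K (m : ZMod n) a = a → (polarMatrix p q p' q' a).det = 0) ∧
      (frobPow K (m : ZMod n) a ≠ a → (polarMatrix p q p' q' a).det = κ) := by
  classical
  have hfin : Module.finrank (ZMod 2) K = Fintype.card (ZMod n) := by
    rw [finrank_eq_of_card hcard, ZMod.card]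
  let b : Module.Basis (ZMod n) (ZMod 2) K :=
    (Module.finBasis (ZMod 2) K).reindex (Fintype.equivOfCardEq (by rw [Fintype.card_fin, hfin]))
  let V : Matrix (ZMod n) (ZMod n) K := Matrix.of fun k i => frobPow K k (b i)
  let G : K → Matrix (ZMod n) (ZMod n) (ZMod 2) := fun a =>
    Matrix.of fun i j => polarForm p q p' q' a (b i) (b j)
  have hG : ∀ a, algebraMap (ZMod 2) K (G a).det =
      V.det ^ 2 * (polarMatrix p q p' q' a).det := by
    intro a
    have : (algebraMap (ZMod 2) K).mapMatrix (G a) =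
        V.transpose * polarMatrix p q p' q' a * V := by
      ext i j
      change algebraMap (ZMod 2) K (polarForm p q p' q' a (b i) (b j)) = _
      rw [algebraMap_polarForm hcard hpq hpq', Finset.sum_comm, Matrix.mul_apply]
      refine Finset.sum_congr rfl fun l _ => ?_
      rw [Matrix.mul_apply, Finset.sum_mul]
      rfl
    rw [RingHom.map_det, this, Matrix.det_mul, Matrix.det_mul, Matrix.det_transpose]
    ring
  have hGE : ∀ a, (G a).det = 0 ↔ frobPow K (m : ZMod n) a = a := by
    intro a
    have hmul : ∀ v i, (G a).mulVec v i = polarForm p q p' q' a (b i) (b.equivFun.symm v) := by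
      intro v i
      rw [Module.Basis.equivFun_symm_apply, map_sum, Matrix.mulVec, dotProduct]
      refine Finset.sum_congr rfl fun j _ => ?_
      rw [map_smul, smul_eq_mul, mul_comm]
      rfl
    rw [← h a, ← Matrix.exists_mulVec_eq_zero_iff]
    constructor
    · rintro ⟨v, hv, hGv⟩
      refine ⟨b.equivFun.symm v, (map_ne_zero_iff _ b.equivFun.symm.injective).2 hv, fun x => ?_⟩
      have : (polarForm p q p' q' a).flip (b.equivFun.symm v) = 0 := by
        refine b.ext fun i => ?_
        change polarForm p q p' q' a (b i) _ = 0
        rw [← hmul, hGv]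
        rfl
      exact LinearMap.congr_fun this x
    · rintro ⟨w, hw, hGw⟩
      refine ⟨b.equivFun w, (map_ne_zero_iff _ b.equivFun.injective).2 hw, funext fun i => ?_⟩
      rw [hmul, LinearEquiv.symm_apply_apply]
      exact hGw (b i)
  have hG1 : ∀ a, frobPow K (m : ZMod n) a ≠ a →
      1 = V.det ^ 2 * (polarMatrix p q p' q' a).det := by
    intro a ha
    rw [← hG a, (show ∀ c : ZMod 2, c ≠ 0 → c = 1 by decide) _ (mt (hGE a).1 ha), map_one]
  obtain ⟨δ, hδ⟩ := exists_add_frobPow_half_eq_one (K := K) hm hn hcard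
  have hV : V.det ^ 2 ≠ 0 := left_ne_zero_of_mul_eq_one (hG1 δ (by rw [hδ]; simp)).symm
  refine ⟨(V.det ^ 2)⁻¹, inv_ne_zero hV, fun a => ⟨fun ha => ?_, fun ha => ?_⟩⟩
  · have := hG a
    rw [(hGE a).2 ha, map_zero] at this
    exact (mul_eq_zero.1 this.symm).resolve_left hV
  · exact eq_inv_of_mul_eq_one_right (hG1 a ha).symm

end PolarMatrix

section TransversalSums

variable {K : Type*} [Field K] [CharP K 2] {n m : ℕ}

lemma prod_frobPow (T : Finset (ZMod n)) (a : K) :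
    ∏ j ∈ T, frobPow K j a = a ^ ∑ j ∈ T, 2 ^ j.val := by
  rw [← Finset.prod_pow_eq_pow_sum]
  exact Finset.prod_congr rfl fun j _ => frobPow_apply j a

variable [NeZero n]

lemma prod_eq_prod_mul_prod_add_half {R : Type*} [CommMonoid R] {T : Finset (ZMod n)}
    (hT : ∀ j, j ∈ T ↔ j + (m : ZMod n) ∉ T) (f : ZMod n → R) :
    ∏ j, f j = (∏ j ∈ T, f j) * ∏ j ∈ T, f (j + m) := by
  rw [← Finset.prod_mul_prod_compl T]
  congr 1
  refine (Finset.prod_equiv (Equiv.addRight (m : ZMod n)) (fun j => ?_) fun j _ => rfl).symm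
  rw [Finset.mem_compl, Equiv.coe_addRight]
  exact hT j

lemma two_mul_card_transversal {T : Finset (ZMod n)}
    (hT : ∀ j, j ∈ T ↔ j + (m : ZMod n) ∉ T) : 2 * #T = n := by
  have h : #T = #Tᶜ := by
    refine Finset.card_equiv (Equiv.addRight (m : ZMod n)) fun j => ?_
    rw [Finset.mem_compl, Equiv.coe_addRight]
    exact hT j
  have := Finset.card_add_card_compl T
  rw [ZMod.card] at this
  omega

variable [Fintype K]

lemma sum_prod_frobPow_eq_zero (hcard : Fintype.card K = 2 ^ n) {T : Finset (ZMod n)}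
    (hT : ∀ j, j ∈ T ↔ j + (m : ZMod n) ∉ T) : ∑ a : K, ∏ j ∈ T, frobPow K j a = 0 := by
  have hn : 0 < n := Nat.pos_of_ne_zero (NeZero.ne n)
  have h2 := two_mul_card_transversal hT
  simp only [prod_frobPow]
  refine sum_pow_eq_zero_of_not_dvd fun hdvd => ?_
  obtain ⟨j, hj⟩ : T.Nonempty := Finset.card_pos.1 (by omega)
  have hpos : 0 < ∑ j ∈ T, 2 ^ j.val := Finset.sum_pos (fun _ _ => by positivity) ⟨j, hj⟩
  have hlt : ∑ j ∈ T, 2 ^ j.val < ∑ j : ZMod n, 2 ^ j.val :=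
    Finset.sum_lt_sum_of_subset (Finset.subset_univ T) (Finset.mem_univ _) ((hT j).1 hj)
      (by positivity) fun _ _ _ => by positivity
  rw [hcard] at hdvd
  rw [sum_two_pow_val] at hlt
  exact absurd (Nat.le_of_dvd hpos hdvd) (not_le.2 hlt)

lemma sum_filter_prod_frobPow_ne_zero [DecidableEq K] (hcard : Fintype.card K = 2 ^ n)
    {T : Finset (ZMod n)} (hT : ∀ j, j ∈ T ↔ j + (m : ZMod n) ∉ T) :
    ∑ a : K with frobPow K (m : ZMod n) a ≠ a, ∏ j ∈ T, frobPow K j a ≠ 0 := by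
  have hn : 0 < n := Nat.pos_of_ne_zero (NeZero.ne n)
  have h2 := two_mul_card_transversal hT
  have hsplit := Finset.sum_filter_not_add_sum_filter (s := (univ : Finset K))
    (p := fun a => frobPow K (m : ZMod n) a = a) (f := fun a => ∏ j ∈ T, frobPow K j a)
  rw [sum_prod_frobPow_eq_zero hcard hT] at hsplit
  intro h0
  rw [h0, zero_add] at hsplit
  have hP : ∀ a ∈ ({a | frobPow K (m : ZMod n) a = a} : Finset K),
      ∏ j ∈ T, frobPow K j a = 1 - if a = 0 then 1 else 0 := by
    intro a ha
    have haE : frobPow K (m : ZMod n) a = a := by simpa using ha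
    split_ifs with ha0
    · obtain ⟨j, hj⟩ : T.Nonempty := Finset.card_pos.1 (by omega)
      rw [Finset.prod_eq_zero hj (by rw [ha0, map_zero]), sub_self]
    · have h1 : ∏ j : ZMod n, frobPow K j a = 1 := by
        rw [prod_frobPow, sum_two_pow_val, ← hcard, FiniteField.pow_card_sub_one_eq_one a ha0]
      rw [prod_eq_prod_mul_prod_add_half hT] at h1
      have h3 : ∀ j : ZMod n, frobPow K (j + (m : ZMod n)) a = frobPow K j a := by
        intro j
        rw [← frobPow_frobPow hcard, haE]
      simp only [h3, ← sq] at h1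
      rw [sub_zero]
      refine frobenius_inj K 2 ?_
      rw [frobenius_def, h1, map_one]
  have hone : ∑ _a : K with frobPow K (m : ZMod n) _a = _a, (1 : K) = 0 := by
    refine Finset.sum_involution (fun a _ => a + 1) ?_ ?_ ?_ ?_
    · intro a _
      exact CharTwo.add_self_eq_zero 1
    · intro a _ _
      simp
    · intro a ha
      simpa using ha
    · intro a _
      rw [add_assoc, CharTwo.add_self_eq_zero, add_zero]
  rw [Finset.sum_congr rfl hP, Finset.sum_sub_distrib, hone, Finset.sum_ite_eq',
    if_pos (by simp)] at hsplit
  simp at hsplit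

end TransversalSums

section Matching

variable {K : Type*} [Field K] [CharP K 2] [Fintype K] {n m : ℕ} [NeZero n] {p q p' q' : ZMod n}

/-- Counting the labels of a matching together with the complement of a transversal: each residue
occurs exactly once. -/
lemma card_labels_eq_one (hcard : Fintype.card K = 2 ^ n) {T H : Finset (ZMod n)}
    (hT : 2 * #T = n) (hH : 2 * #H = n) (lab : ZMod n → ZMod n)
    (hne : ∑ a : K, (∏ i ∈ H, frobPow K (lab i) a) * ∏ j ∈ T, frobPow K j a ≠ 0) (k : ZMod n) :
    #{i ∈ H | lab i = k} + (if k ∈ T then 1 else 0) = 1 := by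
  refine eq_one_of_dvd_sum_two_pow
    (fun k => #{i ∈ H | lab i = k} + if k ∈ T then 1 else 0) ?_ ?_ k
  · rw [Finset.sum_add_distrib, ← Finset.card_eq_sum_card_fiberwise fun _ _ => by simp]
    simp
    omega
  · have hsum : ∑ k : ZMod n, (#{i ∈ H | lab i = k} + if k ∈ T then 1 else 0) * 2 ^ k.val =
        ∑ i ∈ H, 2 ^ (lab i).val + ∑ j ∈ T, 2 ^ j.val := by
      simp only [add_mul, Finset.sum_add_distrib, ite_mul, one_mul, zero_mul]
      congr 1
      · simp only [Finset.card_filter, Finset.sum_mul, ite_mul, one_mul, zero_mul]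
        rw [Finset.sum_comm]
        simp
      · simp
    rw [hsum, ← hcard]
    by_contra hdvd
    apply hne
    rw [← sum_pow_eq_zero_of_not_dvd hdvd]
    refine Finset.sum_congr rfl fun a _ => ?_
    rw [pow_add, prod_frobPow, ← Finset.prod_pow_eq_pow_sum H]
    simp only [frobPow_apply]

variable [Algebra (ZMod 2) K]

lemma DegenerateOnSubfield.transversalsMatch (hm : 0 < m) (hn : n = 2 * m)
    (h : DegenerateOnSubfield K m p q p' q') (hcard : Fintype.card K = 2 ^ n) (hpq : q ≠ p)
    (hpq' : q' ≠ p') : TransversalsMatch m p q p' q' := by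
  classical
  intro U hU
  obtain ⟨κ, hκ, hdet⟩ := h.exists_det_polarMatrix hm hn hcard hpq hpq'
  have hr : Function.Injective (ZMod.val : ZMod n → ℕ) := ZMod.val_injective n
  let g : K → K := fun a => ∑ σ ∈ matchings (ZMod n),
    ∏ i ∈ lowerHalf ZMod.val σ, polarMatrix p q p' q' a (σ i) i
  have hgdet : ∀ a, (polarMatrix p q p' q' a).det = g a ^ 2 := fun a =>
    det_eq_sum_matchings_sq hr _ (polarMatrix_symm a) (polarMatrix_diag hpq hpq' a)
  obtain ⟨δ, hδ⟩ := exists_add_frobPow_half_eq_one (K := K) hm hn hcard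
  have hδE : frobPow K (m : ZMod n) δ ≠ δ := by rw [hδ]; simp
  have hgδ : g δ ≠ 0 := by
    intro h0
    rw [← (hdet δ).2 hδE, hgdet, h0] at hκ
    exact hκ (by ring)
  have hg : ∀ a, g a = if frobPow K (m : ZMod n) a ≠ a then g δ else 0 := by
    intro a
    refine frobenius_inj K 2 ?_
    rw [frobenius_def, ← hgdet]
    split_ifs with ha
    · rw [(hdet a).2 ha, frobenius_def, ← hgdet, (hdet δ).2 hδE]
    · rw [(hdet a).1 (not_not.1 ha), map_zero]
  set T : Finset (ZMod n) := {j | j ∉ U} with hTdef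
  have hT : ∀ j, j ∈ T ↔ j + (m : ZMod n) ∉ T := by
    intro j
    simp only [hTdef, Finset.mem_filter, Finset.mem_univ, true_and, not_not]
    rw [hU j, not_not]
  have hsum : ∑ a, g a * ∏ j ∈ T, frobPow K j a ≠ 0 := by
    rw [Finset.sum_congr rfl fun a _ => by rw [hg a, ite_mul, zero_mul]]
    rw [← Finset.sum_filter, ← Finset.mul_sum]
    exact mul_ne_zero hgδ (sum_filter_prod_frobPow_ne_zero hcard hT)
  simp only [g, Finset.sum_mul] at hsum
  rw [Finset.sum_comm] at hsum
  obtain ⟨σ, hσ, hσsum⟩ := Finset.exists_ne_zero_of_sum_ne_zero hsum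
  obtain ⟨φ, hφ⟩ := exists_choice_of_sum_prod_sum_ne_zero (lowerHalf ZMod.val σ)
    (fun i e a => if EdgeAdj p q p' q' e (σ i) i then frobPow K e.1 a else 0)
    (fun a => ∏ j ∈ T, frobPow K j a) hσsum
  set H := lowerHalf ZMod.val σ with hH
  have hadj : ∀ i ∈ H, EdgeAdj p q p' q' (φ i) (σ i) i := by
    intro i hi
    by_contra hnot
    refine hφ (Finset.sum_eq_zero fun a _ => ?_)
    rw [Finset.prod_eq_zero hi (if_neg hnot), zero_mul]
  rw [Finset.sum_congr rfl fun a _ => by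
    rw [Finset.prod_congr rfl fun i hi => if_pos (hadj i hi)]] at hφ
  have hone := card_labels_eq_one hcard (two_mul_card_transversal hT)
    (by rw [two_mul_card_lowerHalf hr hσ, ZMod.card]) (fun i => (φ i).1) hφ
  have hlabU : ∀ i ∈ H, (φ i).1 ∈ U := by
    intro i hi
    by_contra hnot
    have h1 := hone (φ i).1
    rw [if_pos (by simpa [hTdef] using hnot)] at h1
    have : 0 < #{j ∈ H | (φ j).1 = (φ i).1} :=
      Finset.card_pos.2 ⟨i, Finset.mem_filter.2 ⟨hi, rfl⟩⟩
    omega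
  have hlab : ∀ k ∈ U, ∃ i ∈ H, (φ i).1 = k ∧ ∀ j ∈ H, (φ j).1 = k → j = i := by
    intro k hk
    have h1 := hone k
    rw [if_neg (by simpa [hTdef] using hk), add_zero, Finset.card_eq_one] at h1
    obtain ⟨i, hi⟩ := h1
    have hmem : ∀ j, j ∈ H ∧ (φ j).1 = k ↔ j = i := by
      intro j
      rw [← Finset.mem_singleton (a := i), ← hi, Finset.mem_filter]
    exact ⟨i, ((hmem i).2 rfl).1, ((hmem i).2 rfl).2, fun j hj hjk => (hmem j).1 ⟨hj, hjk⟩⟩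
  choose! ι hιH hιlab hιuniq using hlab
  let τ : ZMod n → Bool := fun k => (φ (ι k)).2
  have hedge : ∀ k ∈ U, ∀ v, EdgeMem p q p' q' τ k v ↔ v = ι k ∨ v = σ (ι k) := by
    intro k hk v
    have h1 := hadj _ (hιH k hk)
    simp only [EdgeAdj, hιlab k hk] at h1
    simp only [EdgeMem, τ]
    rcases h1 with ⟨ht, ⟨h1, h2⟩ | ⟨h1, h2⟩⟩ | ⟨ht, ⟨h1, h2⟩ | ⟨h1, h2⟩⟩ <;>
      simp only [ht, h1, ← h2, true_and, reduceCtorEq, false_and, or_false, false_or] <;> tauto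
  refine ⟨τ, fun v => ?_⟩
  obtain ⟨i, hi, hvi⟩ : ∃ i ∈ H, v = i ∨ v = σ i := by
    by_cases hv : v ∈ H
    · exact ⟨v, hv, Or.inl rfl⟩
    · exact ⟨σ v, (apply_mem_lowerHalf_iff hr hσ v).2 hv,
        Or.inr (apply_apply_of_mem_matchings hσ v).symm⟩
  have hιi : ι (φ i).1 = i := (hιuniq _ (hlabU i hi) i hi rfl).symm
  refine ⟨(φ i).1, ⟨hlabU i hi, (hedge _ (hlabU i hi) v).2 (by rwa [hιi])⟩, ?_⟩
  rintro k ⟨hk, hkv⟩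
  have hkH := hιH k hk
  have hi' : σ i ∉ H := fun hs => (apply_mem_lowerHalf_iff hr hσ i).1 hs hi
  have hk' : σ (ι k) ∉ H := fun hs => (apply_mem_lowerHalf_iff hr hσ (ι k)).1 hs hkH
  have : ι k = i := by
    rcases hvi with rfl | rfl <;> rcases (hedge k hk _).1 hkv with h1 | h1
    · exact h1.symm
    · exact absurd (h1 ▸ hi) hk'
    · exact absurd (h1 ▸ hkH) hi'
    · exact (σ.injective h1).symm
  rw [← this, hιlab k hk]

end Matching

section Classification

variable {K : Type*} [Field K] [CharP K 2] [Fintype K] [Algebra (ZMod 2) K] {n m : ℕ} [NeZero n]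
  {p q p' q' : ZMod n}

lemma DegenerateOnSubfield.eq_of_eq_add_half (hm : 0 < m) (hn : n = 2 * m)
    (h : DegenerateOnSubfield K m p q p' q') (hcard : Fintype.card K = 2 ^ n) (hpq : q ≠ p)
    (hpq' : q' ≠ p') (hp : p' = p + m) : q' = q := by
  have hM := half_add_half hn
  have hT := h.transversalsMatch hm hn hcard hpq hpq'
  have hq := h.ne_add_half hm hn hcard hpq'
  have hq' := h.swap.ne_add_half hm hn hcard hpq
  subst hp
  rw [add_assoc, hM, add_zero] at hq'
  refine (hT.eq_or_eq_add_half hm hn hpq hpq' hq hq').resolve_right fun hc => ?_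
  exact (h.exclusions hm hn hcard).2.1 ⟨rfl, hc⟩

lemma DegenerateOnSubfield.classification (hm : 0 < m) (hn : n = 2 * m)
    (h : DegenerateOnSubfield K m p q p' q') (hcard : Fintype.card K = 2 ^ n) (hpq : q ≠ p)
    (hpq' : q' ≠ p') :
    (p' = p + m ∧ q' = q) ∨ (q' = p + m ∧ p' = q) ∨ (p' = q + m ∧ q' = p) ∨
      (q' = q + m ∧ p' = p) := by
  have hT := h.transversalsMatch hm hn hcard hpq hpq'
  have hq := h.ne_add_half hm hn hcard hpq'
  have hq' := h.swap.ne_add_half hm hn hcard hpq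
  rcases hT.exists_differ hm hn hq hq' with h1 | h1 | h1 | h1
  · exact Or.inl ⟨h1, h.eq_of_eq_add_half hm hn hcard hpq hpq' h1⟩
  · exact Or.inr (Or.inl ⟨h1, h.swap_right.eq_of_eq_add_half hm hn hcard hpq hpq'.symm h1⟩)
  · exact Or.inr (Or.inr (Or.inl
      ⟨h1, h.swap_left.eq_of_eq_add_half hm hn hcard hpq.symm hpq' h1⟩))
  · exact Or.inr (Or.inr (Or.inr
      ⟨h1, h.swap_left.swap_right.eq_of_eq_add_half hm hn hcard hpq.symm hpq'.symm h1⟩))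

end Classification

lemma eq_add_or_eq_add_of_natCast_eq_add_half {n m x y : ℕ} (hn : n = 2 * m) (hx : x < n)
    (hy : y < n) (h : (y : ZMod n) = x + m) : y = x + m ∨ x = y + m := by
  have h1 : (y : ZMod n) = ((x + m : ℕ) : ZMod n) := by rw [h]; push_cast; rfl
  rw [ZMod.natCast_eq_natCast_iff', Nat.mod_eq_of_lt hy] at h1
  rcases Nat.lt_or_ge (x + m) n with h2 | h2
  · left; rwa [Nat.mod_eq_of_lt h2] at h1
  · right
    rw [Nat.mod_eq_sub_mod h2, Nat.mod_eq_of_lt (by omega)] at h1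
    omega

section Counting

variable {K : Type*} [Field K] [Fintype K]

lemma isPrimitiveRoot_of_forall_eq_pow {N : ℕ} (hN : 1 < N) (hcard : Fintype.card K = N + 1)
    {α : K} (hα : ∀ x : K, x ≠ 0 → ∃ k : ℕ, x = α ^ k) : IsPrimitiveRoot α N := by
  classical
  have hα0 : α ≠ 0 := by
    rintro rfl
    have hss : (univ : Finset K) ⊆ {0, 1} := by
      intro x _
      rcases eq_or_ne x 0 with rfl | hx
      · simp
      · obtain ⟨k, rfl⟩ := hα x hx
        rcases Nat.eq_zero_or_pos k with rfl | hk
        · simp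
        · exact absurd (zero_pow hk.ne') hx
    have := (Finset.card_le_card hss).trans Finset.card_le_two
    rw [Finset.card_univ, hcard] at this
    omega
  let u : Kˣ := Units.mk0 α hα0
  have hu : ∀ x : Kˣ, x ∈ Subgroup.zpowers u := by
    intro x
    obtain ⟨k, hk⟩ := hα x x.ne_zero
    exact ⟨k, Units.ext (by simp [u, hk])⟩
  have hord : orderOf u = N := by
    rw [orderOf_eq_card_of_forall_mem_zpowers hu, Nat.card_units, Nat.card_eq_fintype_card, hcard,
      Nat.add_sub_cancel]
  have : orderOf α = N := by rw [← hord, ← orderOf_units]; rfl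
  exact this ▸ IsPrimitiveRoot.orderOf α

lemma gcd_gcd_eq_gcd_two_pow_sub_one {m n a b : ℕ} (hn : n = 2 * m) (hm : 0 < m) :
    Nat.gcd (2 ^ a + 2 ^ b) (Nat.gcd (2 ^ a + 2 ^ (b + m)) (2 ^ n - 1)) =
      Nat.gcd (2 ^ a + 2 ^ b) (2 ^ m - 1) := by
  have hQ : 1 ≤ 2 ^ m := Nat.one_le_two_pow
  have hN : 2 ^ n - 1 = (2 ^ m - 1) * (2 ^ m + 1) := by
    rw [hn, mul_comm 2 m, pow_mul]
    obtain ⟨k, hk⟩ : ∃ k, 2 ^ m = k + 1 := ⟨2 ^ m - 1, by omega⟩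
    rw [hk, Nat.add_sub_cancel]
    have : (k + 1) ^ 2 = k * (k + 1 + 1) + 1 := by ring
    omega
  have hd : 2 ^ a + 2 ^ (b + m) = (2 ^ a + 2 ^ b) + 2 ^ b * (2 ^ m - 1) := by
    rw [Nat.mul_sub, pow_add, mul_one]
    have : 2 ^ b ≤ 2 ^ b * 2 ^ m := Nat.le_mul_of_pos_right _ (by positivity)
    omega
  apply Nat.dvd_antisymm
  · set g := Nat.gcd (2 ^ a + 2 ^ b) (Nat.gcd (2 ^ a + 2 ^ (b + m)) (2 ^ n - 1)) with hg
    have h1 : g ∣ 2 ^ a + 2 ^ b := Nat.gcd_dvd_left _ _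
    have h2 : g ∣ 2 ^ a + 2 ^ (b + m) := (Nat.gcd_dvd_right _ _).trans (Nat.gcd_dvd_left _ _)
    have h3 : g ∣ 2 ^ n - 1 := (Nat.gcd_dvd_right _ _).trans (Nat.gcd_dvd_right _ _)
    refine Nat.dvd_gcd h1 ?_
    rw [hd] at h2
    have h4 := (Nat.dvd_add_right h1).1 h2
    refine Nat.Coprime.dvd_of_dvd_mul_left (Nat.Coprime.pow_right b ?_) h4
    refine Nat.Coprime.coprime_dvd_left h3 ?_
    rw [Nat.coprime_two_right, Nat.odd_iff]
    obtain ⟨k, hk⟩ : ∃ k, n = k + 1 := ⟨n - 1, by omega⟩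
    have : 0 < 2 ^ k := by positivity
    rw [hk, pow_succ]
    omega
  · have h1 := Nat.gcd_dvd_left (2 ^ a + 2 ^ b) (2 ^ m - 1)
    have h2 := Nat.gcd_dvd_right (2 ^ a + 2 ^ b) (2 ^ m - 1)
    refine Nat.dvd_gcd h1 (Nat.dvd_gcd ?_ ?_)
    · rw [hd]
      exact dvd_add h1 (h2.mul_left _)
    · rw [hN]
      exact h2.mul_right _

lemma card_range_of_eq_pow [CharP K 2] {m n : ℕ} (hm : 0 < m) (hn : n = 2 * m)
    (hcard : Fintype.card K = 2 ^ n) {a b s : ℕ} (hs : s = Nat.gcd (2 ^ a + 2 ^ b) (2 ^ m - 1))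
    {F : K → K} (hF : ∀ x, F x = x ^ (2 ^ a + 2 ^ b) + x ^ (2 ^ a + 2 ^ (b + m)))
    {α : K} (hα : ∀ x : K, x ≠ 0 → ∃ k : ℕ, x = α ^ k) :
    Set.ncard (Set.range F) = Set.ncard
      {y : K | ∃ i : ℕ, 1 ≤ i ∧ i ≤ 2 ^ m ∧ y = (F (α ^ i)) ^ ((2 ^ m - 1) / s)} *
        ((2 ^ m - 1) / s) + 1 := by
  classical
  have hQ : 1 < 2 ^ m := Nat.one_lt_two_pow (by omega)
  set Q := 2 ^ m with hQdef
  obtain ⟨R, hR⟩ : ∃ R, Q = R + 1 := ⟨Q - 1, by omega⟩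
  have hR1 : Q - 1 = R := by omega
  rw [hR1] at hs ⊢
  set d := 2 ^ a + 2 ^ b with hd
  have hRpos : 0 < R := by omega
  have hcardR : Fintype.card K = R * (Q + 1) + 1 := by
    rw [hcard, hn, mul_comm 2 m, pow_mul, ← hQdef, hR]
    ring
  have hprim : IsPrimitiveRoot α (R * (Q + 1)) :=
    isPrimitiveRoot_of_forall_eq_pow (by nlinarith) hcardR hα
  have hNpos : 0 < R * (Q + 1) := by positivity
  have hα0 : α ≠ 0 := hprim.ne_zero hNpos.ne'
  have hsR : s ∣ R := hs ▸ Nat.gcd_dvd_right _ _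
  have hsd : s ∣ d := hs ▸ Nat.gcd_dvd_left _ _
  obtain ⟨h, hh⟩ := hsR
  have hspos : 0 < s := Nat.pos_of_ne_zero (by rintro rfl; omega)
  have hhpos : 0 < h := Nat.pos_of_ne_zero (by rintro rfl; omega)
  have hRs : R / s = h := by rw [hh, Nat.mul_div_cancel_left _ hspos]
  rw [hRs]
  set β := α ^ (Q + 1) with hβ
  have hβ0 : β ≠ 0 := pow_ne_zero _ hα0
  have hβR : β ^ R = 1 := by rw [hβ, ← pow_mul, mul_comm, hprim.pow_eq_one]
  have hfac : ∀ x, F x = x ^ 2 ^ a * (x + x ^ Q) ^ 2 ^ b := by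
    intro x
    rw [hF, add_pow_char_pow, mul_add, hd, pow_add, pow_add, pow_add 2 b m, mul_comm (2 ^ b),
      pow_mul]
  have hzero : ∀ x, F x = 0 ↔ x ^ Q = x := by
    intro x
    rw [hfac, mul_eq_zero, pow_eq_zero_iff (by positivity), pow_eq_zero_iff (by positivity),
      CharTwo.add_eq_zero]
    constructor
    · rintro (rfl | hx)
      · exact zero_pow (by omega)
      · exact hx.symm
    · exact fun hx => Or.inr hx.symm
  have hscale : ∀ l x : K, l ^ R = 1 → F (l * x) = l ^ d * F x := by
    intro l x hl
    have hlQ : l ^ Q = l := by rw [hR, pow_succ, hl, one_mul]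
    rw [hfac, hfac, mul_pow, mul_pow l x Q, hlQ, ← mul_add, mul_pow, hd, pow_add]
    ring
  have hpow : ∀ l : K, l ^ R = 1 → (l ^ d) ^ h = 1 := by
    intro l hl
    obtain ⟨e, he⟩ := hsd
    rw [← pow_mul, he, show s * e * h = R * e by rw [hh]; ring, pow_mul, hl, one_pow]
  have hnonzero : ∀ i, 1 ≤ i → i ≤ Q → F (α ^ i) ≠ 0 := by
    intro i hi hiQ h0
    rw [hzero, hR, pow_succ] at h0
    have h1 : (α ^ i) ^ R = 1 :=
      mul_right_cancel₀ (pow_ne_zero i hα0) (by rw [h0, one_mul])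
    rw [← pow_mul, hprim.pow_eq_one_iff_dvd, mul_comm R] at h1
    have := Nat.le_of_dvd hi (Nat.dvd_of_mul_dvd_mul_right hRpos h1)
    omega
  have hroot : ∀ ω : K, ω ^ h = 1 → ∃ l : K, l ^ R = 1 ∧ l ^ d = ω := by
    intro ω hω
    have hprim' : IsPrimitiveRoot (β ^ s) h := by
      rw [hβ, ← pow_mul]
      exact hprim.pow hNpos (by rw [hh]; ring)
    have : NeZero h := ⟨hhpos.ne'⟩
    obtain ⟨j, -, rfl⟩ := hprim'.eq_pow_of_pow_eq_one hω
    refine ⟨(β ^ (Nat.gcdA d R)) ^ j, ?_, ?_⟩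
    · have hz : (β ^ Nat.gcdA d R) ^ R = 1 := by
        rw [← zpow_natCast (β ^ Nat.gcdA d R) R, ← zpow_mul, mul_comm, zpow_mul, zpow_natCast,
          hβR, one_zpow]
      rw [← pow_mul, mul_comm, pow_mul, hz, one_pow]
    · rw [← pow_mul, mul_comm, pow_mul]
      congr 1
      have h1 : (s : ℤ) = d * Nat.gcdA d R + R * Nat.gcdB d R := by
        rw [hs]; exact Nat.gcd_eq_gcd_ab d R
      rw [← zpow_natCast β s, h1, zpow_add₀ hβ0, zpow_mul β R, zpow_natCast β R, hβR, one_zpow,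
        mul_one, ← zpow_natCast (β ^ Nat.gcdA d R) d, ← zpow_mul, mul_comm]
  have hprimh : IsPrimitiveRoot (α ^ (s * (Q + 1))) h := hprim.pow hNpos (by rw [hh]; ring)
  set C : Finset K := (Icc 1 Q).image fun i => F (α ^ i) ^ h with hC
  have hCset : {y : K | ∃ i : ℕ, 1 ≤ i ∧ i ≤ Q ∧ y = F (α ^ i) ^ h} = (C : Set K) := by
    ext y
    simp only [Set.mem_ofPred_eq, hC, Finset.coe_image, Set.mem_image, Finset.mem_coe,
      Finset.mem_Icc]
    constructor
    · rintro ⟨i, h1, h2, rfl⟩; exact ⟨i, ⟨h1, h2⟩, rfl⟩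
    · rintro ⟨i, ⟨h1, h2⟩, rfl⟩; exact ⟨i, h1, h2, rfl⟩
  set Y : Finset K := (univ.image F).erase 0 with hY
  have hYmem : ∀ y, y ∈ Y ↔ y ≠ 0 ∧ ∃ x, F x = y := by
    intro y; simp [hY]
  have hrange : Set.ncard (Set.range F) = #Y + 1 := by
    rw [hY, Finset.card_erase_add_one, ← Set.ncard_coe_finset]
    · simp
    · exact Finset.mem_image.2 ⟨0, Finset.mem_univ _, (hzero 0).2 (zero_pow (by omega))⟩
  rw [hrange, hCset, Set.ncard_coe_finset]
  congr 1
  have hmaps : ∀ y ∈ Y, y ^ h ∈ C := by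
    intro y hy
    obtain ⟨hy0, x, rfl⟩ := (hYmem y).1 hy
    have hx0 : x ≠ 0 := by
      rintro rfl
      exact hy0 ((hzero 0).2 (zero_pow (by omega)))
    obtain ⟨k, rfl⟩ := hα x hx0
    have hk : α ^ k = β ^ (k / (Q + 1)) * α ^ (k % (Q + 1)) := by
      rw [hβ, ← pow_mul, ← pow_add, Nat.div_add_mod]
    have hl : (β ^ (k / (Q + 1))) ^ R = 1 := by rw [← pow_mul, mul_comm, pow_mul, hβR, one_pow]
    rw [hk, hscale _ _ hl] at hy0 ⊢
    have hi : 1 ≤ k % (Q + 1) := by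
      by_contra hlt
      have : k % (Q + 1) = 0 := by omega
      exact right_ne_zero_of_mul hy0 (by rw [this, pow_zero, hzero, one_pow])
    rw [mul_pow, hpow _ hl, one_mul]
    exact Finset.mem_image.2 ⟨_, Finset.mem_Icc.2
      ⟨hi, Nat.lt_succ_iff.1 (Nat.mod_lt _ (by omega))⟩, rfl⟩
  rw [Finset.card_eq_sum_card_fiberwise hmaps]
  refine Finset.sum_const_nat fun z hz => ?_
  obtain ⟨i, hi, rfl⟩ := Finset.mem_image.1 hz
  obtain ⟨hi1, hi2⟩ := Finset.mem_Icc.1 hi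
  have hy0 := hnonzero i hi1 hi2
  have hfib : ({y ∈ Y | y ^ h = F (α ^ i) ^ h} : Finset K) =
      (Polynomial.nthRootsFinset h (1 : K)).image fun ω => ω * F (α ^ i) := by
    ext y
    simp only [Finset.mem_filter, hYmem, Finset.mem_image, Polynomial.mem_nthRootsFinset hhpos]
    constructor
    · rintro ⟨-, hyh⟩
      refine ⟨y / F (α ^ i), ?_, div_mul_cancel₀ _ hy0⟩
      rw [div_pow, hyh, div_self (pow_ne_zero _ hy0)]
    · rintro ⟨ω, hω, rfl⟩
      obtain ⟨l, hl, rfl⟩ := hroot ω hω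
      refine ⟨⟨mul_ne_zero (fun h0 => ?_) hy0, l * α ^ i, hscale _ _ hl⟩, ?_⟩
      · rw [h0, zero_pow hhpos.ne'] at hω
        exact zero_ne_one hω
      · rw [mul_pow, hω, one_mul]
  rw [hfib, Finset.card_image_of_injective _ fun _ _ he => mul_right_cancel₀ hy0 he,
    hprimh.card_nthRootsFinset]

end Counting

lemma exists_exponents_of_ncard_not_isBent {K : Type*} [Field K] [Fintype K] [Algebra (ZMod 2) K]
    [CharP K 2] {m n N : ℕ} (hm : 0 < m) (hn : n = 2 * m) (hN : N = 2 ^ n - 1)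
    (hcard : Fintype.card K = 2 ^ n) {d₁ d₂ : ℕ} (hd₁ : 1 ≤ d₁) (hd₁' : d₁ ≤ N - 1)
    (hd₂ : 1 ≤ d₂) (hd₂' : d₂ ≤ N - 1) (hw₁ : wt2 N (d₁ : ℤ) = 2) (hw₂ : wt2 N (d₂ : ℤ) = 2)
    {F : K → K} (hF : ∀ x, F x = x ^ d₁ + x ^ d₂)
    (hell : ∀ γ : K, Subfield.closure {γ} = ⊤ →
      m < Module.finrank (ZMod 2) (frobSpan K γ))
    (hSF : Set.ncard {a : K | ¬ IsBent m F a} = 2 ^ m) :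
    ∃ a b, (d₁ = 2 ^ a + 2 ^ b ∧ d₂ = 2 ^ a + 2 ^ (b + m)) ∨
      (d₂ = 2 ^ a + 2 ^ b ∧ d₁ = 2 ^ a + 2 ^ (b + m)) := by
  have : NeZero n := ⟨by omega⟩
  obtain ⟨p, q, hpq, hq, rfl⟩ := exists_eq_two_pow_add_of_wt2_eq_two hN hd₁ hd₁' hw₁
  obtain ⟨p', q', hpq', hq', rfl⟩ := exists_eq_two_pow_add_of_wt2_eq_two hN hd₂ hd₂' hw₂
  have hS := not_isBent_iff_pow_eq_self hm hn hcard (F := F)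
    (fun v => by rw [hF, hF, CharTwo.add_sq, pow_right_comm, pow_right_comm v 2]) hell hSF
  have hinj : ∀ x y : ℕ, x < n → y < n → (x : ZMod n) = y → x = y := by
    intro x y hx hy hxy
    rwa [ZMod.natCast_eq_natCast_iff', Nat.mod_eq_of_lt hx, Nat.mod_eq_of_lt hy] at hxy
  have hdeg : DegenerateOnSubfield K m (p : ZMod n) q p' q' := by
    refine .of_isBent hn hcard (fun x => ?_) hS
    simp only [hF, frobPow_natCast hcard, pow_add]
  have hp := hpq.trans hq
  have hp' := hpq'.trans hq'
  rcases hdeg.classification hm hn hcard (fun h => hpq.ne' (hinj _ _ hq hp h))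
    (fun h => hpq'.ne' (hinj _ _ hq' hp' h)) with ⟨h1, h2⟩ | ⟨h1, h2⟩ | ⟨h1, h2⟩ | ⟨h1, h2⟩
  · obtain rfl := hinj _ _ hq' hq h2
    rcases eq_add_or_eq_add_of_natCast_eq_add_half hn hp hp' h1 with rfl | rfl
    · exact ⟨q', p, Or.inl ⟨add_comm _ _, add_comm _ _⟩⟩
    · exact ⟨q', p', Or.inr ⟨add_comm _ _, add_comm _ _⟩⟩
  · obtain rfl := hinj _ _ hp' hq h2
    rcases eq_add_or_eq_add_of_natCast_eq_add_half hn hp hq' h1 with rfl | rfl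
    · exact ⟨p', p, Or.inl ⟨add_comm _ _, rfl⟩⟩
    · exact ⟨p', q', Or.inr ⟨rfl, add_comm _ _⟩⟩
  · obtain rfl := hinj _ _ hq' hp h2
    rcases eq_add_or_eq_add_of_natCast_eq_add_half hn hq hp' h1 with rfl | rfl
    · exact ⟨q', q, Or.inl ⟨rfl, add_comm _ _⟩⟩
    · exact ⟨q', p', Or.inr ⟨add_comm _ _, rfl⟩⟩
  · obtain rfl := hinj _ _ hp' hp h2
    rcases eq_add_or_eq_add_of_natCast_eq_add_half hn hq hq' h1 with rfl | rfl
    · exact ⟨p', q, Or.inl ⟨rfl, rfl⟩⟩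
    · exact ⟨p', q', Or.inr ⟨rfl, rfl⟩⟩

/-- Let `n = 2m`, `N = 2^n − 1`, `F(x) = x^{d₁} + x^{d₂}` with `wt₂(d₁) = wt₂(d₂) = 2` and
`s = gcd(d₁, d₂, N) > 1`.  Assume `ℓ(n) > m` and `#S_F = 2^m`.  If `α` generates
`F_{2^n}^*` and `c = #{F(α^i)^{(2^m−1)/s} : i = 1, …, 2^m}`, then
`#Im(F) = (2^m − 1)·c/s + 1`. -/
theorem stmt18 (m n : ℕ) (hm : 0 < m) (hn : n = 2 * m) (N : ℕ) (hN : N = 2 ^ n - 1)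
    (K : Type*) [Field K] [Fintype K] [Algebra (ZMod 2) K]
    (hcard : Fintype.card K = 2 ^ n)
    (d₁ d₂ : ℕ) (hd₁ : 1 ≤ d₁) (hd₁' : d₁ ≤ N - 1) (hd₂ : 1 ≤ d₂) (hd₂' : d₂ ≤ N - 1)
    (hw₁ : wt2 N (d₁ : ℤ) = 2) (hw₂ : wt2 N (d₂ : ℤ) = 2)
    (s : ℕ) (hs : s = Nat.gcd d₁ (Nat.gcd d₂ N)) (hs1 : 1 < s)
    (F : K → K) (hF : ∀ x, F x = x ^ d₁ + x ^ d₂)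
    (hell : ∀ γ : K, Subfield.closure {γ} = ⊤ →
      m < Module.finrank (ZMod 2) (frobSpan K γ))
    (hSF : Set.ncard {a : K | ¬ IsBent m F a} = 2 ^ m)
    (α : K) (hα : ∀ x : K, x ≠ 0 → ∃ k : ℕ, x = α ^ k)
    (c : ℕ)
    (hc : c = Set.ncard
      {y : K | ∃ i : ℕ, 1 ≤ i ∧ i ≤ 2 ^ m ∧ y = (F (α ^ i)) ^ ((2 ^ m - 1) / s)}) :
    (Set.ncard (Set.range F) : ℚ) = ((2 : ℚ) ^ m - 1) * c / s + 1 := by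
  have : CharP K 2 := charP_of_injective_algebraMap (algebraMap (ZMod 2) K).injective 2
  obtain ⟨a, b, hab⟩ := exists_exponents_of_ncard_not_isBent hm hn hN hcard hd₁ hd₁' hd₂ hd₂'
    hw₁ hw₂ hF hell hSF
  have hs' : s = Nat.gcd (2 ^ a + 2 ^ b) (2 ^ m - 1) := by
    rw [← gcd_gcd_eq_gcd_two_pow_sub_one hn hm, hs, hN]
    rcases hab with ⟨rfl, rfl⟩ | ⟨rfl, rfl⟩
    · rfl
    · exact Nat.gcd_left_comm _ _ _
  have hF' : ∀ x, F x = x ^ (2 ^ a + 2 ^ b) + x ^ (2 ^ a + 2 ^ (b + m)) := by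
    intro x
    rw [hF]
    rcases hab with ⟨rfl, rfl⟩ | ⟨rfl, rfl⟩
    · rfl
    · exact add_comm _ _
  have hsm : s ∣ 2 ^ m - 1 := hs' ▸ Nat.gcd_dvd_right _ _
  have hs0 : (s : ℚ) ≠ 0 := by exact_mod_cast (by omega : s ≠ 0)
  rw [card_range_of_eq_pow hm hn hcard hs' hF' hα, ← hc]
  push_cast [Nat.cast_div hsm hs0, Nat.cast_sub (Nat.one_le_two_pow (n := m))]
  ring
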